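/- arXiv:math/0409548 — 3 statements merged into one kernel-verified Lean document; each statement's English description precedes it below -/
import Mathlib

section
/- In the additive Gaussian channel y = ρx + w, the expectation under the law of y of the trace of the Hessian of log ℓ equals ρ² E|x − E[x|y]|², i.e. E₁[trace ∇² log ℓ] = ρ² (E|x|² − E|E[x|y]|²) = ρ² E|x|² − E₁|∇ log ℓ|². -/
open MeasureTheory Real
open scoped RealInnerProductSpace ENNReal

noncomputable def stdGaussian (n : ℕ) : Measure (EuclideanSpace ℝ (Fin n)) :=
  volume.withDensity
    (fun w => ENNReal.ofReal ((2 * π) ^ (-(n : ℝ) / 2) * Real.exp (-‖w‖ ^ 2 / 2)))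

noncomputable def lik (n : ℕ) (ρ : ℝ) (μX : Measure (EuclideanSpace ℝ (Fin n)))
    (u : EuclideanSpace ℝ (Fin n)) : ℝ :=
  ∫ x, Real.exp (ρ * ⟪u, x⟫ - ρ ^ 2 / 2 * ‖x‖ ^ 2) ∂μX

noncomputable def postExp (n : ℕ) (ρ : ℝ) (μX : Measure (EuclideanSpace ℝ (Fin n)))
    (F : EuclideanSpace ℝ (Fin n) → ℝ) (u : EuclideanSpace ℝ (Fin n)) : ℝ :=
  (lik n ρ μX u)⁻¹ * ∫ x, Real.exp (ρ * ⟪u, x⟫ - ρ ^ 2 / 2 * ‖x‖ ^ 2) * F x ∂μX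

noncomputable def postMean (n : ℕ) (ρ : ℝ) (μX : Measure (EuclideanSpace ℝ (Fin n)))
    (u : EuclideanSpace ℝ (Fin n)) : EuclideanSpace ℝ (Fin n) :=
  (lik n ρ μX u)⁻¹ • ∫ x, Real.exp (ρ * ⟪u, x⟫ - ρ ^ 2 / 2 * ‖x‖ ^ 2) • x ∂μX
noncomputable def lawY (n : ℕ) (ρ : ℝ) (μX : Measure (EuclideanSpace ℝ (Fin n))) :
    Measure (EuclideanSpace ℝ (Fin n)) :=
  Measure.map (fun p : EuclideanSpace ℝ (Fin n) × EuclideanSpace ℝ (Fin n) =>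
    ρ • p.1 + p.2) (μX.prod (stdGaussian n))

section aux

variable {n : ℕ} {ρ : ℝ} {μX : Measure (EuclideanSpace ℝ (Fin n))}

/-- The exponential kernel. -/
noncomputable def kerE (n : ℕ) (ρ : ℝ) (u x : EuclideanSpace ℝ (Fin n)) : ℝ :=
  Real.exp (ρ * ⟪u, x⟫ - ρ ^ 2 / 2 * ‖x‖ ^ 2)

lemma kerE_pos (u x : EuclideanSpace ℝ (Fin n)) : 0 < kerE n ρ u x := Real.exp_pos _

lemma kerE_cont : Continuous (fun p : EuclideanSpace ℝ (Fin n) × EuclideanSpace ℝ (Fin n) =>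
    kerE n ρ p.1 p.2) := by
  unfold kerE
  fun_prop

lemma kerE_cont_right (u : EuclideanSpace ℝ (Fin n)) : Continuous (kerE n ρ u) := by
  unfold kerE
  fun_prop

lemma kerE_le (u x : EuclideanSpace ℝ (Fin n)) : kerE n ρ u x ≤ Real.exp (‖u‖ ^ 2 / 2) := by
  unfold kerE
  apply Real.exp_le_exp.2
  have h : 0 ≤ ‖u - ρ • x‖ ^ 2 := by positivity
  rw [norm_sub_sq_real, inner_smul_right, norm_smul, mul_pow, Real.norm_eq_abs, sq_abs] at h
  linarith

lemma integrable_sq [IsProbabilityMeasure μX]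
    (hexp : ∀ (α : ℝ) (h : EuclideanSpace ℝ (Fin n)),
      Integrable (fun x => Real.exp (α * ⟪x, h⟫)) μX) :
    Integrable (fun x => ‖x‖ ^ 2) μX := by
  simp_rw [EuclideanSpace.real_norm_sq_eq]
  refine integrable_finsetSum _ fun i _ => ?_
  have h1 := hexp 1 (EuclideanSpace.single i 1)
  have h2 := hexp (-1) (EuclideanSpace.single i 1)
  refine Integrable.mono' ((h1.add h2).const_mul 2) (by fun_prop) (ae_of_all _ fun x => ?_)
  simp only [EuclideanSpace.inner_single_right, Pi.add_apply, one_mul, neg_mul]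
  simp only [conj_trivial, Real.norm_eq_abs, abs_pow, sq_abs]
  rcases le_total 0 (x i) with h | h
  · have := Real.quadratic_le_exp_of_nonneg h
    have := Real.exp_pos (-(x i))
    nlinarith
  · have := Real.quadratic_le_exp_of_nonneg (neg_nonneg.2 h)
    have := Real.exp_pos (x i)
    nlinarith

lemma integrable_ker_smul {F : Type*} [NormedAddCommGroup F] [NormedSpace ℝ F]
    [IsProbabilityMeasure μX]
    (h2 : Integrable (fun x => ‖x‖ ^ 2) μX) (u : EuclideanSpace ℝ (Fin n))
    (H : EuclideanSpace ℝ (Fin n) → F) (hc : Continuous H) (C : ℝ)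
    (hb : ∀ x, ‖H x‖ ≤ C * (1 + ‖x‖ ^ 2)) :
    Integrable (fun x => kerE n ρ u x • H x) μX := by
  have hI : Integrable (fun x => Real.exp (‖u‖ ^ 2 / 2) * (C * (1 + ‖x‖ ^ 2))) μX :=
    (((integrable_const (1 : ℝ)).add h2).const_mul C).const_mul _
  refine Integrable.mono' hI
    ((kerE_cont_right u).smul hc).aestronglyMeasurable (ae_of_all _ fun x => ?_)
  rw [norm_smul, Real.norm_eq_abs, abs_of_pos (kerE_pos u x)]
  exact mul_le_mul (kerE_le u x) (hb x) (norm_nonneg _) (Real.exp_pos _).le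

lemma kerE_hasFDerivAt (u x : EuclideanSpace ℝ (Fin n)) :
    HasFDerivAt (fun v => kerE n ρ v x) (kerE n ρ u x • (ρ • innerSL ℝ x)) u := by
  unfold kerE
  have h : HasFDerivAt (fun v : EuclideanSpace ℝ (Fin n) => ρ * ⟪v, x⟫ - ρ ^ 2 / 2 * ‖x‖ ^ 2)
      (ρ • innerSL ℝ x) u := by
    have h0 : HasFDerivAt (fun v : EuclideanSpace ℝ (Fin n) => ⟪v, x⟫) (innerSL ℝ x) u := by
      have := (innerSL ℝ x).hasFDerivAt (x := u)
      refine this.congr_of_eventuallyEq (Filter.Eventually.of_forall fun v => ?_)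
      simp [real_inner_comm]
    exact (h0.const_mul ρ).sub_const _
  exact h.exp

lemma hasFDerivAt_ker {F : Type*} [NormedAddCommGroup F] [NormedSpace ℝ F]
    [IsProbabilityMeasure μX]
    (h2 : Integrable (fun x => ‖x‖ ^ 2) μX) (u : EuclideanSpace ℝ (Fin n))
    (H : EuclideanSpace ℝ (Fin n) → F) (hc : Continuous H) (C : ℝ) (hC : 0 ≤ C)
    (hb : ∀ x, ‖H x‖ ≤ C * (1 + ‖x‖)) :
    HasFDerivAt (fun v => ∫ x, kerE n ρ v x • H x ∂μX)
      (∫ x, kerE n ρ u x • ((ρ • innerSL ℝ x).smulRight (H x)) ∂μX) u := by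
  have hcF : Continuous (fun x => ((ρ • innerSL ℝ x).smulRight (H x) :
      EuclideanSpace ℝ (Fin n) →L[ℝ] F)) := by
    have h1 : Continuous (fun x : EuclideanSpace ℝ (Fin n) => ρ • innerSL ℝ x) := by fun_prop
    exact ((ContinuousLinearMap.smulRightL ℝ (EuclideanSpace ℝ (Fin n)) F).continuous.comp
      h1).clm_apply hc
  have hI : Integrable (fun x => Real.exp ((‖u‖ + 1) ^ 2 / 2) *
      (|ρ| * (C * (2 * (1 + ‖x‖ ^ 2))))) μX :=
    (((((integrable_const (1 : ℝ)).add h2).const_mul 2).const_mul C).const_mul _).const_mul _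
  refine hasFDerivAt_integral_of_dominated_of_fderiv_le
    (F' := fun v x => kerE n ρ v x • ((ρ • innerSL ℝ x).smulRight (H x)))
    (Metric.ball_mem_nhds u one_pos)
    (Filter.Eventually.of_forall fun v => ((kerE_cont_right v).smul hc).aestronglyMeasurable)
    (integrable_ker_smul h2 u H hc (2 * C) fun x => ?_)
    ((kerE_cont_right u).smul hcF).aestronglyMeasurable
    (ae_of_all _ fun x v hv => ?_) hI (ae_of_all _ fun x v hv => ?_)
  · refine (hb x).trans ?_
    have : 1 + ‖x‖ ≤ 2 * (1 + ‖x‖ ^ 2) := by nlinarith [sq_nonneg (‖x‖ - 1)]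
    nlinarith
  · rw [norm_smul, Real.norm_eq_abs, abs_of_pos (kerE_pos v x),
      ContinuousLinearMap.norm_smulRight_apply, norm_smul, innerSL_apply_norm, Real.norm_eq_abs,
      mul_assoc]
    have hv' : ‖v‖ ≤ ‖u‖ + 1 := by
      have h1 : ‖v - u‖ < 1 := by simpa [dist_eq_norm] using hv
      have h3 := norm_le_norm_add_norm_sub' v u
      linarith
    have hk : kerE n ρ v x ≤ Real.exp ((‖u‖ + 1) ^ 2 / 2) := by
      refine (kerE_le v x).trans (Real.exp_le_exp.2 ?_)
      gcongr
    have h4 : ‖x‖ * ‖H x‖ ≤ C * (2 * (1 + ‖x‖ ^ 2)) := by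
      have h5 := mul_le_mul_of_nonneg_left (hb x) (norm_nonneg x)
      have : ‖x‖ * (1 + ‖x‖) ≤ 2 * (1 + ‖x‖ ^ 2) := by nlinarith [sq_nonneg (‖x‖ - 1)]
      nlinarith
    gcongr
  · have := (kerE_hasFDerivAt (ρ := ρ) v x).smul_const (H x)
    convert this using 1
    ext y
    simp [mul_assoc, mul_smul]

/-- unnormalized first moment -/
noncomputable def mom1 (n : ℕ) (ρ : ℝ) (μX : Measure (EuclideanSpace ℝ (Fin n)))
    (u : EuclideanSpace ℝ (Fin n)) : EuclideanSpace ℝ (Fin n) :=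
  ∫ x, kerE n ρ u x • x ∂μX

/-- unnormalized second moment -/
noncomputable def mom2 (n : ℕ) (ρ : ℝ) (μX : Measure (EuclideanSpace ℝ (Fin n)))
    (u : EuclideanSpace ℝ (Fin n)) : ℝ :=
  ∫ x, kerE n ρ u x * ‖x‖ ^ 2 ∂μX

lemma norm_le_aux (t : ℝ) : t ≤ 1 * (1 + t ^ 2) := by nlinarith [sq_nonneg (t - 1)]

lemma int0 [IsProbabilityMeasure μX] (h2 : Integrable (fun x => ‖x‖ ^ 2) μX)
    (u : EuclideanSpace ℝ (Fin n)) : Integrable (fun x => kerE n ρ u x) μX := by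
  have := integrable_ker_smul (ρ := ρ) h2 u (fun _ => (1 : ℝ)) continuous_const 1
    (fun x => by simp)
  simpa using this

lemma int1 [IsProbabilityMeasure μX] (h2 : Integrable (fun x => ‖x‖ ^ 2) μX)
    (u : EuclideanSpace ℝ (Fin n)) : Integrable (fun x => kerE n ρ u x • x) μX :=
  integrable_ker_smul (ρ := ρ) h2 u (fun x => x) continuous_id 1 (fun x => norm_le_aux _)

lemma int2 [IsProbabilityMeasure μX] (h2 : Integrable (fun x => ‖x‖ ^ 2) μX)
    (u : EuclideanSpace ℝ (Fin n)) : Integrable (fun x => kerE n ρ u x * ‖x‖ ^ 2) μX :=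
  integrable_ker_smul (ρ := ρ) h2 u (fun x => ‖x‖ ^ 2) (by fun_prop) 1 (fun x => by simp)

lemma lik_eq (u : EuclideanSpace ℝ (Fin n)) : lik n ρ μX u = ∫ x, kerE n ρ u x ∂μX := rfl

lemma hasFDerivAt_lik [IsProbabilityMeasure μX] (h2 : Integrable (fun x => ‖x‖ ^ 2) μX)
    (u : EuclideanSpace ℝ (Fin n)) :
    HasFDerivAt (lik n ρ μX) (∫ x, kerE n ρ u x • (ρ • innerSL ℝ x) ∂μX) u := by
  have h := hasFDerivAt_ker (ρ := ρ) h2 u (fun _ => (1 : ℝ)) continuous_const 1 zero_le_one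
    (fun x => by simp)
  have e1 : (fun v => ∫ x, kerE n ρ v x • (1 : ℝ) ∂μX) = lik n ρ μX := by
    funext v; simp [lik_eq]
  have e2 : ∀ L : EuclideanSpace ℝ (Fin n) →L[ℝ] ℝ, L.smulRight (1 : ℝ) = L := by
    intro L; ext; simp
  simpa only [e1, e2] using h

lemma hess_bound (x : EuclideanSpace ℝ (Fin n)) :
    ‖(ρ • innerSL ℝ x : EuclideanSpace ℝ (Fin n) →L[ℝ] ℝ)‖ ≤ |ρ| * (1 + ‖x‖) := by
  rw [norm_smul, innerSL_apply_norm, Real.norm_eq_abs]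
  have := abs_nonneg ρ
  nlinarith

lemma hess_bound2 (x : EuclideanSpace ℝ (Fin n)) :
    ‖(ρ • innerSL ℝ x : EuclideanSpace ℝ (Fin n) →L[ℝ] ℝ)‖ ≤ |ρ| * (1 + ‖x‖ ^ 2) := by
  rw [norm_smul, innerSL_apply_norm, Real.norm_eq_abs]
  have := norm_le_aux ‖x‖
  rw [one_mul] at this
  gcongr

lemma grad_apply [IsProbabilityMeasure μX] (h2 : Integrable (fun x => ‖x‖ ^ 2) μX)
    (u v : EuclideanSpace ℝ (Fin n)) :
    (∫ x, kerE n ρ u x • (ρ • innerSL ℝ x) ∂μX : EuclideanSpace ℝ (Fin n) →L[ℝ] ℝ) v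
      = ρ * ⟪mom1 n ρ μX u, v⟫ := by
  rw [ContinuousLinearMap.integral_apply
    (integrable_ker_smul h2 u _ (by fun_prop) |ρ| hess_bound2)]
  rw [mom1, real_inner_comm, ← integral_inner (int1 h2 u), ← integral_const_mul]
  congr 1
  funext x
  simp only [FunLike.coe_smul, Pi.smul_apply, innerSL_apply_apply, smul_eq_mul, inner_smul_right,
    real_inner_comm v x]
  ring

lemma hess_apply [IsProbabilityMeasure μX] (h2 : Integrable (fun x => ‖x‖ ^ 2) μX)
    (u v : EuclideanSpace ℝ (Fin n)) :
    (∫ x, kerE n ρ u x • ((ρ • innerSL ℝ x).smulRight (ρ • innerSL ℝ x)) ∂μX :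
      EuclideanSpace ℝ (Fin n) →L[ℝ] EuclideanSpace ℝ (Fin n) →L[ℝ] ℝ) v v
      = ρ ^ 2 * ∫ x, kerE n ρ u x * ⟪x, v⟫ ^ 2 ∂μX := by
  have hcF : Continuous (fun x => ((ρ • innerSL ℝ x).smulRight (ρ • innerSL ℝ x) :
      EuclideanSpace ℝ (Fin n) →L[ℝ] EuclideanSpace ℝ (Fin n) →L[ℝ] ℝ)) := by
    have h1 : Continuous (fun x : EuclideanSpace ℝ (Fin n) => ρ • innerSL ℝ x) := by fun_prop
    exact ((ContinuousLinearMap.smulRightL ℝ (EuclideanSpace ℝ (Fin n)) _).continuous.comp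
      h1).clm_apply h1
  have hi := integrable_ker_smul (ρ := ρ) h2 u (fun x => ((ρ • innerSL ℝ x).smulRight (ρ • innerSL ℝ x) :
      EuclideanSpace ℝ (Fin n) →L[ℝ] EuclideanSpace ℝ (Fin n) →L[ℝ] ℝ)) hcF (ρ ^ 2) (fun x => by
    rw [ContinuousLinearMap.norm_smulRight_apply, norm_smul, innerSL_apply_norm, Real.norm_eq_abs,
      ← sq_abs ρ]
    nlinarith [sq_nonneg (|ρ|)])
  rw [ContinuousLinearMap.integral_apply hi,
    ContinuousLinearMap.integral_apply (hi.apply_continuousLinearMap v), ← integral_const_mul]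
  congr 1
  funext x
  simp only [FunLike.coe_smul, Pi.smul_apply, innerSL_apply_apply, smul_eq_mul,
    ContinuousLinearMap.smulRight_apply]
  ring

lemma hasFDerivAt_log [IsProbabilityMeasure μX] (h2 : Integrable (fun x => ‖x‖ ^ 2) μX)
    (hpos : ∀ u, 0 < lik n ρ μX u) (u : EuclideanSpace ℝ (Fin n)) :
    HasFDerivAt (fun v => Real.log (lik n ρ μX v))
      ((lik n ρ μX u)⁻¹ • ∫ x, kerE n ρ u x • (ρ • innerSL ℝ x) ∂μX) u :=
  (hasFDerivAt_lik h2 u).log (hpos u).ne'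

lemma postMean_eq (u : EuclideanSpace ℝ (Fin n)) :
    postMean n ρ μX u = (lik n ρ μX u)⁻¹ • mom1 n ρ μX u := rfl

lemma gradient_log_eq [IsProbabilityMeasure μX] (h2 : Integrable (fun x => ‖x‖ ^ 2) μX)
    (hpos : ∀ u, 0 < lik n ρ μX u) (u : EuclideanSpace ℝ (Fin n)) :
    gradient (fun v => Real.log (lik n ρ μX v)) u = ρ • postMean n ρ μX u := by
  refine ext_inner_right ℝ fun v => ?_
  rw [gradient, InnerProductSpace.toDual_symm_apply, (hasFDerivAt_log h2 hpos u).fderiv,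
    postMean_eq]
  simp only [FunLike.coe_smul, Pi.smul_apply, grad_apply h2, smul_eq_mul, real_inner_smul_left]
  ring

lemma iter_eq [IsProbabilityMeasure μX] (h2 : Integrable (fun x => ‖x‖ ^ 2) μX)
    (hpos : ∀ u, 0 < lik n ρ μX u) (u v : EuclideanSpace ℝ (Fin n)) :
    iteratedFDeriv ℝ 2 (fun v => Real.log (lik n ρ μX v)) u (fun _ => v)
     = ρ ^ 2 * ((lik n ρ μX u)⁻¹ * (∫ x, kerE n ρ u x * ⟪x, v⟫ ^ 2 ∂μX)
        - ⟪postMean n ρ μX u, v⟫ ^ 2) := by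
  rw [iteratedFDeriv_two_apply]
  have e : fderiv ℝ (fun v => Real.log (lik n ρ μX v)) = fun u =>
      (lik n ρ μX u)⁻¹ • ∫ x, kerE n ρ u x • (ρ • innerSL ℝ x) ∂μX := by
    funext w
    exact (hasFDerivAt_log h2 hpos w).fderiv
  rw [e]
  have hG := hasFDerivAt_ker (ρ := ρ) h2 u
    (fun x => (ρ • innerSL ℝ x : EuclideanSpace ℝ (Fin n) →L[ℝ] ℝ)) (by fun_prop) |ρ|
    (abs_nonneg ρ) hess_bound
  have hi := (hasDerivAt_inv (hpos u).ne').comp_hasFDerivAt u (hasFDerivAt_lik (ρ := ρ) h2 u)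
  have hS := hi.smul hG
  have := hS.fderiv
  simp only [Function.comp_def] at this
  change fderiv ℝ (fun u => (lik n ρ μX u)⁻¹ •
    ∫ x, kerE n ρ u x • (ρ • innerSL ℝ x) ∂μX) u = _ at this
  rw [this]
  simp only [FunLike.coe_smul, Pi.smul_apply, add_apply,
    ContinuousLinearMap.smulRight_apply, hess_apply h2, grad_apply h2, smul_eq_mul, postMean_eq,
    real_inner_smul_left]
  field_simp [(hpos u).ne']
  ring

lemma trace_eq [IsProbabilityMeasure μX] (h2 : Integrable (fun x => ‖x‖ ^ 2) μX)
    (hpos : ∀ u, 0 < lik n ρ μX u) (u : EuclideanSpace ℝ (Fin n)) :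
    (∑ i : Fin n, iteratedFDeriv ℝ 2 (fun v => Real.log (lik n ρ μX v)) u
          (fun _ => EuclideanSpace.single i (1 : ℝ)))
     = ρ ^ 2 * ((lik n ρ μX u)⁻¹ * mom2 n ρ μX u - ‖postMean n ρ μX u‖ ^ 2) := by
  simp_rw [iter_eq h2 hpos]
  rw [← Finset.mul_sum, Finset.sum_sub_distrib, ← Finset.mul_sum, mom2,
    EuclideanSpace.real_norm_sq_eq (postMean n ρ μX u), ← integral_finsetSum]
  · simp only [EuclideanSpace.inner_single_right, one_mul, conj_trivial, ← Finset.mul_sum,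
      EuclideanSpace.real_norm_sq_eq]
  · intro i _
    refine integrable_ker_smul (ρ := ρ) h2 u
      (fun x => ⟪x, EuclideanSpace.single i (1 : ℝ)⟫ ^ 2) (by fun_prop) 1 fun x => ?_
    have := abs_real_inner_le_norm x (EuclideanSpace.single i (1 : ℝ))
    rw [EuclideanSpace.norm_single, norm_one, mul_one] at this
    rw [norm_pow, Real.norm_eq_abs]
    have h3 := pow_le_pow_left₀ (abs_nonneg _) this 2
    linarith

lemma postMean_sq_le [IsProbabilityMeasure μX] (h2 : Integrable (fun x => ‖x‖ ^ 2) μX)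
    (hpos : ∀ u, 0 < lik n ρ μX u) (u : EuclideanSpace ℝ (Fin n)) :
    ‖postMean n ρ μX u‖ ^ 2 ≤ (lik n ρ μX u)⁻¹ * mom2 n ρ μX u := by
  set m := postMean n ρ μX u with hm
  have hM : mom1 n ρ μX u = lik n ρ μX u • m := by
    rw [hm, postMean_eq, smul_smul, mul_inv_cancel₀ (hpos u).ne', one_smul]
  have h0 : 0 ≤ ∫ x, kerE n ρ u x * ‖x - m‖ ^ 2 ∂μX :=
    integral_nonneg fun x => mul_nonneg (kerE_pos u x).le (by positivity)
  have e : ∀ x, kerE n ρ u x * ‖x - m‖ ^ 2 = kerE n ρ u x * ‖x‖ ^ 2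
      - 2 * ⟪m, kerE n ρ u x • x⟫ + kerE n ρ u x * ‖m‖ ^ 2 := by
    intro x
    rw [norm_sub_sq_real, inner_smul_right, real_inner_comm]
    ring
  have hi1 : Integrable (fun x => 2 * ⟪m, kerE n ρ u x • x⟫) μX :=
    ((int1 h2 u).const_inner m).const_mul 2
  simp_rw [e] at h0
  have hi3 : Integrable (fun x => kerE n ρ u x * ‖x‖ ^ 2 - 2 * ⟪m, kerE n ρ u x • x⟫) μX :=
    (int2 h2 u).sub hi1
  rw [integral_add hi3 ((int0 h2 u).mul_const _),
    integral_sub (int2 h2 u) hi1, integral_const_mul, integral_inner (int1 h2 u),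
    integral_mul_const, ← lik_eq] at h0
  change 0 ≤ mom2 n ρ μX u - 2 * ⟪m, mom1 n ρ μX u⟫ + _ at h0
  rw [hM, inner_smul_right, real_inner_self_eq_norm_sq] at h0
  rw [← div_eq_inv_mul, le_div_iff₀ (hpos u)]
  linarith

/-- Gaussian density -/
noncomputable def gd (n : ℕ) (w : EuclideanSpace ℝ (Fin n)) : ℝ :=
  (2 * π) ^ (-(n : ℝ) / 2) * Real.exp (-‖w‖ ^ 2 / 2)

lemma gd_pos (w : EuclideanSpace ℝ (Fin n)) : 0 < gd n w := by
  unfold gd; positivity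

lemma gd_cont : Continuous (gd n) := by
  unfold gd; fun_prop

lemma gd_int : ∫ w, gd n w = 1 := by
  unfold gd
  rw [integral_const_mul]
  have := GaussianFourier.integral_rexp_neg_mul_sq_norm (V := EuclideanSpace ℝ (Fin n))
    (b := 1 / 2) (by norm_num)
  have e : ∀ w : EuclideanSpace ℝ (Fin n), -‖w‖ ^ 2 / 2 = -(1 / 2) * ‖w‖ ^ 2 := fun w => by ring
  simp_rw [e]
  rw [this, finrank_euclideanSpace_fin, show π / (1 / 2) = 2 * π by ring,
    ← Real.rpow_add (by positivity)]
  rw [show -(n : ℝ) / 2 + n / 2 = 0 by ring, Real.rpow_zero]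

lemma gd_shift (u x : EuclideanSpace ℝ (Fin n)) :
    gd n (u - ρ • x) = gd n u * kerE n ρ u x := by
  unfold gd kerE
  rw [mul_assoc, ← Real.exp_add, norm_sub_sq_real, inner_smul_right, norm_smul, mul_pow,
    Real.norm_eq_abs, sq_abs]
  congr 2
  ring

lemma gd_integrable : Integrable (gd n) := by
  by_contra h
  have := gd_int (n := n)
  rw [integral_undef h] at this
  norm_num at this

lemma lik_cont [IsProbabilityMeasure μX] (h2 : Integrable (fun x => ‖x‖ ^ 2) μX) :
    Continuous (lik n ρ μX) :=
  continuous_iff_continuousAt.2 fun u => (hasFDerivAt_lik h2 u).continuousAt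

lemma lawY_eq [IsProbabilityMeasure μX] (h2 : Integrable (fun x => ‖x‖ ^ 2) μX) :
    lawY n ρ μX = volume.withDensity (fun u => ENNReal.ofReal (gd n u * lik n ρ μX u)) := by
  have hg : stdGaussian n = volume.withDensity (fun w => ENNReal.ofReal (gd n w)) := rfl
  have hgm : Measurable (fun w => ENNReal.ofReal (gd n w)) := gd_cont.measurable.ennreal_ofReal
  haveI : SFinite (stdGaussian n) := by rw [hg]; infer_instance
  have hlm : Measurable (fun u => ENNReal.ofReal (gd n u * lik n ρ μX u)) :=
    (gd_cont.mul (lik_cont h2)).measurable.ennreal_ofReal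
  refine Measure.ext_of_lintegral _ fun f hf => ?_
  have hk : Measurable (fun p : EuclideanSpace ℝ (Fin n) × EuclideanSpace ℝ (Fin n) =>
      kerE n ρ p.1 p.2) := kerE_cont.measurable
  rw [lawY, lintegral_map hf (by fun_prop), lintegral_prod _ (by fun_prop),
    lintegral_withDensity_eq_lintegral_mul _ hlm hf]
  have e1 : ∀ x, ∫⁻ w, f (ρ • x + w) ∂(stdGaussian n)
      = ∫⁻ u, ENNReal.ofReal (gd n u * kerE n ρ u x) * f u := by
    intro x
    rw [hg, lintegral_withDensity_eq_lintegral_mul _ hgm (by fun_prop)]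
    rw [← lintegral_add_left_eq_self
      (fun u => ENNReal.ofReal (gd n u * kerE n ρ u x) * f u) (ρ • x)]
    refine lintegral_congr fun w => ?_
    rw [← gd_shift]
    simp
  simp_rw [e1]
  have hm2 : Measurable (fun p : EuclideanSpace ℝ (Fin n) × EuclideanSpace ℝ (Fin n) =>
      ENNReal.ofReal (gd n p.2 * kerE n ρ p.2 p.1) * f p.2) := by
    refine Measurable.mul ?_ (by fun_prop)
    exact ((gd_cont.comp continuous_snd).mul
      (kerE_cont.comp continuous_swap)).measurable.ennreal_ofReal
  rw [lintegral_lintegral_swap hm2.aemeasurable]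
  refine lintegral_congr fun u => ?_
  have hku : Measurable (fun x => ENNReal.ofReal (gd n u * kerE n ρ u x)) :=
    ((kerE_cont_right u).const_mul _).measurable.ennreal_ofReal
  rw [lintegral_mul_const _ hku, Pi.mul_apply]
  congr 1
  rw [lik_eq, ← integral_const_mul, ofReal_integral_eq_lintegral_ofReal
    ((int0 h2 u).const_mul _) (ae_of_all _ fun x => (mul_pos (gd_pos u) (kerE_pos u x)).le)]

lemma joint_int [IsProbabilityMeasure μX] (h2 : Integrable (fun x => ‖x‖ ^ 2) μX) :
    Integrable (fun p : EuclideanSpace ℝ (Fin n) × EuclideanSpace ℝ (Fin n) =>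
      gd n p.1 * (kerE n ρ p.1 p.2 * ‖p.2‖ ^ 2)) (volume.prod μX) := by
  have hc : Continuous (fun p : EuclideanSpace ℝ (Fin n) × EuclideanSpace ℝ (Fin n) =>
      gd n p.1 * (kerE n ρ p.1 p.2 * ‖p.2‖ ^ 2)) :=
    (gd_cont.comp continuous_fst).mul (kerE_cont.mul (by fun_prop))
  rw [integrable_prod_iff' hc.aestronglyMeasurable]
  have e : ∀ x u : EuclideanSpace ℝ (Fin n), gd n u * (kerE n ρ u x * ‖x‖ ^ 2)
      = gd n (u - ρ • x) * ‖x‖ ^ 2 := by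
    intro x u; rw [gd_shift]; ring
  simp only [e]
  constructor
  · exact ae_of_all _ fun x => (gd_integrable.comp_sub_right (ρ • x)).mul_const _
  · have e3 : ∀ x u : EuclideanSpace ℝ (Fin n), ‖gd n (u - ρ • x) * ‖x‖ ^ 2‖
        = gd n (u - ρ • x) * ‖x‖ ^ 2 := fun x u =>
      Real.norm_of_nonneg (mul_nonneg (gd_pos _).le (by positivity))
    simp only [e3, integral_mul_const, integral_sub_right_eq_self (gd n), gd_int, one_mul]
    exact h2

lemma post_integral [IsProbabilityMeasure μX] (h2 : Integrable (fun x => ‖x‖ ^ 2) μX)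
    (hpos : ∀ u, 0 < lik n ρ μX u) :
    Integrable (fun u => (lik n ρ μX u)⁻¹ * mom2 n ρ μX u) (lawY n ρ μX) ∧
    ∫ u, (lik n ρ μX u)⁻¹ * mom2 n ρ μX u ∂(lawY n ρ μX) = ∫ x, ‖x‖ ^ 2 ∂μX := by
  have hm : Measurable (fun u => ENNReal.ofReal (gd n u * lik n ρ μX u)) :=
    (gd_cont.mul (lik_cont h2)).measurable.ennreal_ofReal
  have e : ∀ u, (ENNReal.ofReal (gd n u * lik n ρ μX u)).toReal •
      ((lik n ρ μX u)⁻¹ * mom2 n ρ μX u)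
      = ∫ x, gd n u * (kerE n ρ u x * ‖x‖ ^ 2) ∂μX := by
    intro u
    rw [ENNReal.toReal_ofReal (mul_pos (gd_pos u) (hpos u)).le, integral_const_mul, smul_eq_mul,
      ← mom2]
    field_simp [(hpos u).ne']
  rw [lawY_eq h2]
  constructor
  · rw [integrable_withDensity_iff_integrable_smul' hm (ae_of_all _ fun _ => ENNReal.ofReal_lt_top)]
    simp_rw [e]
    exact (joint_int h2).integral_prod_left
  · rw [integral_withDensity_eq_integral_toReal_smul hm
      (ae_of_all _ fun _ => ENNReal.ofReal_lt_top)]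
    simp_rw [e]
    rw [integral_integral_swap (f := fun u x => gd n u * (kerE n ρ u x * ‖x‖ ^ 2)) (joint_int h2)]
    congr 1
    funext x
    have e2 : ∀ u : EuclideanSpace ℝ (Fin n), gd n u * (kerE n ρ u x * ‖x‖ ^ 2)
        = gd n (u - ρ • x) * ‖x‖ ^ 2 := by
      intro u; rw [gd_shift]; ring
    simp only [e2, integral_mul_const, integral_sub_right_eq_self (gd n), gd_int, one_mul]

lemma postMean_cont [IsProbabilityMeasure μX] (h2 : Integrable (fun x => ‖x‖ ^ 2) μX)
    (hpos : ∀ u, 0 < lik n ρ μX u) : Continuous (postMean n ρ μX) := by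
  have h1 : Continuous (mom1 n ρ μX) := continuous_iff_continuousAt.2 fun u =>
    (hasFDerivAt_ker (ρ := ρ) h2 u (fun x => x) continuous_id 1 zero_le_one
      (fun x => by linarith)).continuousAt
  exact ((lik_cont h2).inv₀ fun u => (hpos u).ne').smul h1

end aux

/-- E₁[trace ∇² log ℓ] = ρ²(E|x|² − E₁|E[x|y]|²) = ρ²E|x|² − E₁|∇ log ℓ|². -/
theorem expected_trace_hessian_log_likelihood (n : ℕ) (ρ : ℝ) (hρ : 0 < ρ)
    (μX : Measure (EuclideanSpace ℝ (Fin n))) [IsProbabilityMeasure μX]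
    (hexp : ∀ (α : ℝ) (h : EuclideanSpace ℝ (Fin n)),
      Integrable (fun x => Real.exp (α * ⟪x, h⟫)) μX)
    (hpos : ∀ u, 0 < lik n ρ μX u) :
    (∫ u, (∑ i : Fin n, iteratedFDeriv ℝ 2 (fun v => Real.log (lik n ρ μX v)) u
          (fun _ => EuclideanSpace.single i (1 : ℝ))) ∂(lawY n ρ μX)
        = ρ ^ 2 * ((∫ x, ‖x‖ ^ 2 ∂μX) - ∫ u, ‖postMean n ρ μX u‖ ^ 2 ∂(lawY n ρ μX))) ∧
    (∫ u, (∑ i : Fin n, iteratedFDeriv ℝ 2 (fun v => Real.log (lik n ρ μX v)) u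
          (fun _ => EuclideanSpace.single i (1 : ℝ))) ∂(lawY n ρ μX)
        = ρ ^ 2 * (∫ x, ‖x‖ ^ 2 ∂μX)
          - ∫ u, ‖gradient (fun v => Real.log (lik n ρ μX v)) u‖ ^ 2 ∂(lawY n ρ μX)) := by
  have h2 := integrable_sq hexp
  obtain ⟨hi, he⟩ := post_integral h2 hpos
  have hi2 : Integrable (fun u => ‖postMean n ρ μX u‖ ^ 2) (lawY n ρ μX) := by
    refine Integrable.mono' hi ((postMean_cont h2 hpos).norm.pow 2).aestronglyMeasurable
      (ae_of_all _ fun u => ?_)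
    rw [Real.norm_of_nonneg (by positivity)]
    exact postMean_sq_le h2 hpos u
  have key : ∫ u, (∑ i : Fin n, iteratedFDeriv ℝ 2 (fun v => Real.log (lik n ρ μX v)) u
          (fun _ => EuclideanSpace.single i (1 : ℝ))) ∂(lawY n ρ μX)
        = ρ ^ 2 * ((∫ x, ‖x‖ ^ 2 ∂μX) - ∫ u, ‖postMean n ρ μX u‖ ^ 2 ∂(lawY n ρ μX)) := by
    simp_rw [trace_eq h2 hpos]
    rw [integral_const_mul, integral_sub hi hi2, he]
  refine ⟨key, ?_⟩
  rw [key]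
  simp_rw [gradient_log_eq h2 hpos, norm_smul, mul_pow, Real.norm_eq_abs, sq_abs]
  rw [integral_const_mul]
  ring
end

section
/- (I-MMSE / GSV relation) In the additive Gaussian channel y = ρx + w, the mutual information I(X;Y) between x and y, as a function of ρ, satisfies dI/dρ = ρ E|x − E[x|y]|² = ρ (E|x|² − E|E[x|y]|²). -/
open MeasureTheory Real
open scoped RealInnerProductSpace ENNReal

noncomputable def lawXY (n : ℕ) (ρ : ℝ) (μX : Measure (EuclideanSpace ℝ (Fin n))) :
    Measure (EuclideanSpace ℝ (Fin n) × EuclideanSpace ℝ (Fin n)) :=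
  Measure.map (fun p : EuclideanSpace ℝ (Fin n) × EuclideanSpace ℝ (Fin n) =>
    (p.1, ρ • p.1 + p.2)) (μX.prod (stdGaussian n))

/-- Mutual information between x and y = ρx + w. -/
noncomputable def mutualInfo (n : ℕ) (ρ : ℝ) (μX : Measure (EuclideanSpace ℝ (Fin n))) : ℝ :=
  ∫ θ, Real.log (((lawXY n ρ μX).rnDeriv (μX.prod (lawY n ρ μX))) θ).toReal ∂(lawXY n ρ μX)


namespace GSV

noncomputable def cc (n : ℕ) : ℝ := (2 * π) ^ (-(n : ℝ) / 2)

noncomputable def gd (n : ℕ) (w : EuclideanSpace ℝ (Fin n)) : ℝ :=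
  (2 * π) ^ (-(n : ℝ) / 2) * Real.exp (-‖w‖ ^ 2 / 2)

variable {n : ℕ}

local notation "EE" => EuclideanSpace ℝ (Fin n)

lemma cc_pos : 0 < cc n := by unfold cc; positivity

lemma gd_eq (w : EE) : gd n w = cc n * Real.exp (-‖w‖ ^ 2 / 2) := rfl

lemma gd_pos (w : EE) : 0 < gd n w := by
  rw [gd_eq]; exact mul_pos cc_pos (Real.exp_pos _)

lemma gd_le (w : EE) : gd n w ≤ cc n := by
  rw [gd_eq]
  apply mul_le_of_le_one_right cc_pos.le
  rw [Real.exp_le_one_iff]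
  have := sq_nonneg ‖w‖
  linarith

lemma gd_cont : Continuous (gd n) := by unfold gd; fun_prop

lemma gd_neg (w : EE) : gd n (-w) = gd n w := by simp [gd]

lemma log_gd (w : EE) : Real.log (gd n w) = Real.log (cc n) - ‖w‖ ^ 2 / 2 := by
  rw [gd_eq, Real.log_mul cc_pos.ne' (Real.exp_pos _).ne', Real.log_exp]; ring

lemma norm_mul_gd_le (w : EE) : ‖w‖ * gd n w ≤ cc n := by
  rw [gd_eq, mul_left_comm]
  apply mul_le_of_le_one_right cc_pos.le
  have h : ‖w‖ ≤ Real.exp (‖w‖ ^ 2 / 2) := by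
    have := Real.add_one_le_exp (‖w‖ ^ 2 / 2)
    nlinarith [sq_nonneg (‖w‖ - 1)]
  calc ‖w‖ * Real.exp (-‖w‖ ^ 2 / 2) ≤ Real.exp (‖w‖ ^ 2 / 2) * Real.exp (-‖w‖ ^ 2 / 2) := by gcongr
    _ = 1 := by rw [← Real.exp_add]; simp [neg_div]

lemma pow_mul_gd_le (K : ℕ) (w : EE) :
    (1 + ‖w‖) ^ K * gd n w ≤ cc n * (K.factorial * Real.exp 2) := by
  rw [gd_eq, mul_left_comm]
  refine mul_le_mul_of_nonneg_left ?_ cc_pos.le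
  have h1 := Real.pow_div_factorial_le_exp (1 + ‖w‖) (by positivity) K
  rw [div_le_iff₀ (by positivity)] at h1
  calc _ ≤ (Real.exp (1 + ‖w‖) * K.factorial) * Real.exp (-‖w‖ ^ 2 / 2) := by gcongr
    _ = K.factorial * Real.exp (1 + ‖w‖ + -‖w‖ ^ 2 / 2) := by rw [Real.exp_add (1 + ‖w‖)]; ring
    _ ≤ _ := by
      gcongr
      nlinarith [sq_nonneg (‖w‖ - 1)]

lemma peetre (R : ℝ) (hR : 0 ≤ R) (K : ℕ) : ∃ C, 0 ≤ C ∧ ∀ r : ℝ, |r| ≤ R → ∀ x w : EE,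
    (1 + ‖w‖) ^ K * gd n (w - r • x) ≤ C * (1 + ‖x‖) ^ K := by
  refine ⟨cc n * (K.factorial * Real.exp 2) * (1 + R) ^ K, ?_, ?_⟩
  · have := cc_pos (n := n); positivity
  intro r hr x w
  have h0 : ‖w‖ ≤ ‖w - r • x‖ + R * ‖x‖ := by
    calc ‖w‖ = ‖(w - r • x) + r • x‖ := by simp
      _ ≤ ‖w - r • x‖ + ‖r • x‖ := norm_add_le _ _
      _ ≤ _ := by rw [norm_smul, Real.norm_eq_abs]; gcongr
  have h1 : 1 + ‖w‖ ≤ (1 + ‖w - r • x‖) * ((1 + R) * (1 + ‖x‖)) := by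
    have := norm_nonneg (w - r • x)
    have h2 := norm_nonneg x
    nlinarith [mul_nonneg hR h2, mul_nonneg this hR, mul_nonneg this h2, mul_nonneg this (mul_nonneg hR h2)]
  calc _ ≤ ((1 + ‖w - r • x‖) * ((1 + R) * (1 + ‖x‖))) ^ K * gd n (w - r • x) := by
        have := gd_pos (w - r • x)
        gcongr
    _ = ((1 + ‖w - r • x‖) ^ K * gd n (w - r • x)) * (1 + R) ^ K * (1 + ‖x‖) ^ K := by
        rw [mul_pow, mul_pow]; ring
    _ ≤ _ := by
        have := pow_mul_gd_le K (w - r • x)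
        gcongr

lemma gd_integral : ∫ w, gd n w = 1 := by
  unfold gd
  rw [integral_const_mul]
  have h := GaussianFourier.integral_rexp_neg_mul_sq_norm (V := EE) (b := 1/2) (by norm_num)
  have e : ∀ w : EE, Real.exp (-‖w‖ ^ 2 / 2) = Real.exp (-(1/2) * ‖w‖ ^ 2) := by
    intro w; congr 1; ring
  simp_rw [e]
  rw [h, finrank_euclideanSpace, Fintype.card_fin, show π / (1/2) = 2 * π by ring,
    ← Real.rpow_add (by positivity)]
  rw [show -(n:ℝ)/2 + n/2 = 0 by ring, Real.rpow_zero]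

lemma moments (μ : Measure EE) [IsProbabilityMeasure μ]
    (hexp : ∀ (α : ℝ) (h : EuclideanSpace ℝ (Fin n)),
      Integrable (fun x => Real.exp (α * ⟪x, h⟫)) μ) (K : ℕ) :
    Integrable (fun x : EE => (1 + ‖x‖) ^ K) μ := by
  have hi : ∀ i : Fin n, Integrable (fun x : EE => Real.exp ((n:ℝ) * x i) + Real.exp (-(n:ℝ) * x i)) μ := by
    intro i
    have h1 := hexp n (EuclideanSpace.single i 1)
    have h2 := hexp (-n) (EuclideanSpace.single i 1)
    simp only [EuclideanSpace.inner_single_right, one_mul, conj_trivial] at h1 h2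
    exact h1.add h2
  have hs : Integrable (fun x : EE => (K.factorial * Real.exp 1) *
      (1 + ∑ i : Fin n, (Real.exp ((n:ℝ) * x i) + Real.exp (-(n:ℝ) * x i)))) μ :=
    ((integrable_const 1).add (integrable_finsetSum _ fun i _ => hi i)).const_mul _
  refine hs.mono' (by fun_prop) (Filter.Eventually.of_forall fun x => ?_)
  rw [Real.norm_of_nonneg (by positivity)]
  have h1 := Real.pow_div_factorial_le_exp (1 + ‖x‖) (by positivity) K
  rw [div_le_iff₀ (by positivity)] at h1
  have key : Real.exp ‖x‖ ≤ 1 + ∑ i : Fin n, (Real.exp ((n:ℝ) * x i) + Real.exp (-(n:ℝ) * x i)) := by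
    have hnn : ∀ i : Fin n, 0 ≤ (Real.exp ((n:ℝ) * x i) + Real.exp (-(n:ℝ) * x i)) := fun i => by positivity
    have hsn : ‖x‖ ≤ ∑ i : Fin n, |x i| := by
      have hx : x = ∑ i : Fin n, EuclideanSpace.single i (x i) := by
        ext j; simp [Finset.sum_apply]
      calc ‖x‖ = ‖∑ i : Fin n, EuclideanSpace.single i (x i)‖ := by rw [← hx]
        _ ≤ ∑ i : Fin n, ‖EuclideanSpace.single i (x i)‖ := norm_sum_le _ _
        _ = _ := by simp
    rcases Nat.eq_zero_or_pos n with hn | hn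
    · subst hn
      have : ‖x‖ ≤ 0 := by simpa using hsn
      simpa using this
    · have : Nonempty (Fin n) := ⟨⟨0, hn⟩⟩
      obtain ⟨i, _, him⟩ := Finset.exists_max_image (Finset.univ : Finset (Fin n)) (fun i => |x i|) Finset.univ_nonempty
      have h2 : ‖x‖ ≤ n * |x i| := by
        refine hsn.trans ((Finset.sum_le_card_nsmul _ _ _ fun j hj => him j hj).trans ?_)
        simp
      have h3 : Real.exp ‖x‖ ≤ Real.exp ((n:ℝ) * x i) + Real.exp (-(n:ℝ) * x i) := by
        refine (Real.exp_le_exp.2 h2).trans ?_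
        rcases abs_cases (x i) with ⟨h, _⟩ | ⟨h, _⟩ <;> rw [h]
        · linarith [Real.exp_pos (-(n:ℝ) * x i)]
        · rw [show (n:ℝ) * -(x i) = -(n:ℝ) * x i by ring]
          linarith [Real.exp_pos ((n:ℝ) * x i)]
      have h4 := Finset.single_le_sum (f := fun i => Real.exp ((n:ℝ) * x i) + Real.exp (-(n:ℝ) * x i)) (fun j _ => hnn j) (Finset.mem_univ i)
      simp only at h4
      linarith
  calc _ ≤ Real.exp (1 + ‖x‖) * K.factorial := h1
    _ = (K.factorial * Real.exp 1) * Real.exp ‖x‖ := by rw [Real.exp_add]; ring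
    _ ≤ _ := by gcongr

lemma integrable_weight : Integrable (fun w : EE => ((1 + ‖w‖) ^ (n + 1))⁻¹) volume := by
  have := integrable_one_add_norm (E := EE) (μ := volume) (r := (n + 1 : ℕ)) (by simp)
  refine this.congr (Filter.Eventually.of_forall fun w => ?_)
  simp only
  rw [Real.rpow_neg (by positivity), Real.rpow_natCast]

lemma integrable_prod_of_bound (μ : Measure EE) [IsProbabilityMeasure μ]
    (hm : ∀ K : ℕ, Integrable (fun x : EE => (1 + ‖x‖) ^ K) μ)
    {F : EE × EE → ℝ} (hF : AEStronglyMeasurable F (μ.prod volume)) (r C : ℝ) (a b : ℕ)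
    (hb : ∀ x w, |F (x, w)| ≤ C * ((1 + ‖x‖) ^ a * ((1 + ‖w‖) ^ b * gd n (w - r • x)))) :
    Integrable F (μ.prod volume) := by
  obtain ⟨P, hP, hPe⟩ := peetre (n := n) |r| (abs_nonneg r) (b + (n + 1))
  have hC : 0 ≤ C := by
    have h := (abs_nonneg _).trans (hb 0 0)
    have h2 : 0 < (1 + ‖(0:EE)‖) ^ a * ((1 + ‖(0:EE)‖) ^ b * gd n ((0:EE) - r • (0:EE))) := by
      have := gd_pos ((0:EE) - r • (0:EE)); positivity
    by_contra hc
    push Not at hc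
    nlinarith
  have hI := ((hm (a + (b + (n + 1)))).const_mul (C * P)).mul_prod (integrable_weight (n := n))
  refine hI.mono' hF (Filter.Eventually.of_forall fun ⟨x, w⟩ => ?_)
  refine (hb x w).trans ?_
  have h1 : (1 + ‖w‖) ^ b * gd n (w - r • x) ≤ P * (1 + ‖x‖) ^ (b + (n+1)) * ((1 + ‖w‖) ^ (n + 1))⁻¹ := by
    rw [← div_eq_mul_inv, le_div_iff₀ (by positivity)]
    refine le_trans (le_of_eq ?_) (hPe r le_rfl x w)
    rw [pow_add]; ring
  calc _ ≤ C * ((1 + ‖x‖) ^ a * (P * (1 + ‖x‖) ^ (b + (n+1)) * ((1 + ‖w‖) ^ (n + 1))⁻¹)) := by gcongr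
    _ = _ := by simp only; rw [pow_add (1 + ‖x‖) a]; ring

noncomputable def DD (μ : Measure EE) (r : ℝ) (w : EE) : ℝ := ∫ x, gd n (w - r • x) ∂μ

noncomputable def NN (μ : Measure EE) (r : ℝ) (w : EE) : EE := ∫ x, gd n (w - r • x) • x ∂μ

lemma G_cont (r : ℝ) : Continuous (fun p : EE × EE => gd n (p.2 - r • p.1)) :=
  gd_cont.comp (by fun_prop)

lemma G_cont_x (r : ℝ) (w : EE) : Continuous (fun x : EE => gd n (w - r • x)) :=
  gd_cont.comp (by fun_prop)

lemma G_cont_w (r : ℝ) (x : EE) : Continuous (fun w : EE => gd n (w - r • x)) :=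
  gd_cont.comp (by fun_prop)

lemma G_int (μ : Measure EE) [IsProbabilityMeasure μ] (r : ℝ) (w : EE) :
    Integrable (fun x => gd n (w - r • x)) μ := by
  refine (integrable_const (cc n)).mono' (G_cont_x r w).aestronglyMeasurable
    (Filter.Eventually.of_forall fun x => ?_)
  rw [Real.norm_of_nonneg (gd_pos _).le]; exact gd_le _

lemma Gx_int (μ : Measure EE) [IsProbabilityMeasure μ]
    (h1 : Integrable (fun x : EE => ‖x‖) μ) (r : ℝ) (w : EE) :
    Integrable (fun x => gd n (w - r • x) • x) μ := by
  refine (h1.const_mul (cc n)).mono' ((G_cont_x r w).smul continuous_id).aestronglyMeasurable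
    (Filter.Eventually.of_forall fun x => ?_)
  rw [norm_smul, Real.norm_of_nonneg (gd_pos _).le]
  have := gd_le (w - r • x)
  gcongr

lemma DD_cont (μ : Measure EE) [IsProbabilityMeasure μ] (r : ℝ) : Continuous (DD μ r) := by
  refine continuous_of_dominated (bound := fun _ => cc n) (fun w => (G_cont_x r w).aestronglyMeasurable)
    (fun w => Filter.Eventually.of_forall fun x => ?_) (integrable_const _)
    (Filter.Eventually.of_forall fun x => G_cont_w r x)
  rw [Real.norm_of_nonneg (gd_pos _).le]; exact gd_le _

lemma NN_cont (μ : Measure EE) [IsProbabilityMeasure μ]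
    (h1 : Integrable (fun x : EE => ‖x‖) μ) (r : ℝ) : Continuous (NN μ r) := by
  refine continuous_of_dominated (bound := fun x => cc n * ‖x‖)
    (fun w => ((G_cont_x r w).smul continuous_id).aestronglyMeasurable)
    (fun w => Filter.Eventually.of_forall fun x => ?_) (h1.const_mul _)
    (Filter.Eventually.of_forall fun x => (G_cont_w r x).smul continuous_const)
  rw [norm_smul, Real.norm_of_nonneg (gd_pos _).le]
  have := gd_le (w - r • x)
  gcongr

lemma DD_pos (μ : Measure EE) [IsProbabilityMeasure μ] (r : ℝ) (w : EE) : 0 < DD μ r w := by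
  unfold DD
  rw [integral_pos_iff_support_of_nonneg (fun x => (gd_pos _).le) (G_int μ r w)]
  have : (Function.support fun x => gd n (w - r • x)) = Set.univ := by
    ext x; simp [(gd_pos (w - r • x)).ne']
  rw [this]; simp

lemma DD_le (μ : Measure EE) [IsProbabilityMeasure μ] (r : ℝ) (w : EE) : DD μ r w ≤ cc n := by
  have := integral_mono (G_int μ r w) (integrable_const (cc n)) (fun x => gd_le _)
  unfold DD
  simpa using this

lemma DD_lower (μ : Measure EE) [IsProbabilityMeasure μ] (R : ℝ) :
    ∃ B, 1 ≤ B ∧ ∀ r, |r| ≤ R → ∀ w : EE, cc n * Real.exp (-(B * (1 + ‖w‖) ^ 2)) ≤ DD μ r w := by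
  have hi : Integrable (fun x : EE => Real.exp (-(R ^ 2 * ‖x‖ ^ 2))) μ := by
    refine (integrable_const (1:ℝ)).mono' (by fun_prop) (Filter.Eventually.of_forall fun x => ?_)
    rw [Real.norm_of_nonneg (Real.exp_pos _).le, Real.exp_le_one_iff]
    have : 0 ≤ R ^ 2 * ‖x‖ ^ 2 := by positivity
    linarith
  set κ := ∫ x, Real.exp (-(R ^ 2 * ‖x‖ ^ 2)) ∂μ with hκ
  have hκp : 0 < κ := integral_exp_pos hi
  refine ⟨1 + |Real.log κ|, by linarith [abs_nonneg (Real.log κ)], fun r hr w => ?_⟩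
  have h1 : cc n * Real.exp (-‖w‖ ^ 2) * κ ≤ DD μ r w := by
    rw [hκ, ← integral_const_mul]
    refine integral_mono (hi.const_mul _) (G_int μ r w) fun x => ?_
    simp only
    rw [gd_eq, mul_assoc, ← Real.exp_add]
    refine mul_le_mul_of_nonneg_left (Real.exp_le_exp.2 ?_) cc_pos.le
    have h2 : ‖w - r • x‖ ≤ ‖w‖ + R * ‖x‖ := by
      refine (norm_sub_le _ _).trans ?_
      rw [norm_smul, Real.norm_eq_abs]; gcongr
    have h3 : ‖w - r • x‖ ^ 2 ≤ (‖w‖ + R * ‖x‖) ^ 2 := by gcongr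
    nlinarith [sq_nonneg (‖w‖ - R * ‖x‖)]
  refine le_trans ?_ h1
  rw [mul_assoc]
  refine mul_le_mul_of_nonneg_left ?_ cc_pos.le
  rw [← Real.exp_log hκp, ← Real.exp_add, Real.log_exp]
  refine Real.exp_le_exp.2 ?_
  have := neg_abs_le (Real.log κ)
  have h4 := abs_nonneg (Real.log κ)
  have h5 := norm_nonneg w
  nlinarith [mul_nonneg h4 h5, mul_nonneg h4 (sq_nonneg ‖w‖)]

lemma log_DD_bound (μ : Measure EE) [IsProbabilityMeasure μ] (R : ℝ) :
    ∃ B, 0 ≤ B ∧ ∀ r, |r| ≤ R → ∀ w : EE, |Real.log (DD μ r w)| ≤ B * (1 + ‖w‖) ^ 2 := by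
  obtain ⟨B, hB, h⟩ := DD_lower μ R
  refine ⟨B + |Real.log (cc n)|, by positivity, fun r hr w => ?_⟩
  have h1 := Real.log_le_log (by have := cc_pos (n := n); positivity) (h r hr w)
  rw [Real.log_mul cc_pos.ne' (Real.exp_pos _).ne', Real.log_exp] at h1
  have h2 := Real.log_le_log (DD_pos μ r w) (DD_le μ r w)
  have h3 := neg_abs_le (Real.log (cc n))
  have h4 := le_abs_self (Real.log (cc n))
  have h5 : 1 ≤ (1 + ‖w‖) ^ 2 := one_le_pow₀ (by linarith [norm_nonneg w])
  have h6 := abs_nonneg (Real.log (cc n))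
  rw [abs_le]
  constructor <;> nlinarith

lemma NN_bound (μ : Measure EE) [IsProbabilityMeasure μ] (r : ℝ) (hr : 0 < r) :
    ∃ C, 0 ≤ C ∧ ∀ w : EE, ‖NN μ r w‖ ≤ C * (1 + ‖w‖) * DD μ r w := by
  obtain ⟨B, hB, h⟩ := DD_lower μ |r|
  refine ⟨r⁻¹ * (2 * B + 2), by positivity, fun w => ?_⟩
  have hD := h r le_rfl w
  have hDp := DD_pos μ r w
  set A := 2 * B * (1 + ‖w‖) with hA
  have hA0 : 0 ≤ A := by positivity
  have hpt : ∀ x : EE, ‖gd n (w - r • x) • x‖ ≤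
      r⁻¹ * ((A + ‖w‖) * gd n (w - r • x) + cc n * Real.exp (-A ^ 2 / 4)) := by
    intro x
    have g0 := gd_pos (w - r • x)
    rw [norm_smul, Real.norm_of_nonneg g0.le]
    have hx : ‖x‖ ≤ r⁻¹ * (‖w - r • x‖ + ‖w‖) := by
      rw [← div_eq_inv_mul, le_div_iff₀ hr]
      calc ‖x‖ * r = ‖r • x‖ := by rw [norm_smul, Real.norm_of_nonneg hr.le]; ring
        _ = ‖w - (w - r • x)‖ := by simp
        _ ≤ _ := by linarith [norm_sub_le w (w - r • x)]
    have ht : ‖w - r • x‖ * gd n (w - r • x) ≤ A * gd n (w - r • x) + cc n * Real.exp (-A ^ 2 / 4) := by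
      set t := ‖w - r • x‖ with htt
      rcases le_total t A with hc | hc
      · have : 0 ≤ cc n * Real.exp (-A ^ 2 / 4) := mul_nonneg cc_pos.le (Real.exp_pos _).le
        nlinarith
      · have h0 : 0 ≤ A * gd n (w - r • x) := by positivity
        suffices t * gd n (w - r • x) ≤ cc n * Real.exp (-A ^ 2 / 4) by linarith
        rw [gd_eq, mul_left_comm, ← htt]
        refine mul_le_mul_of_nonneg_left ?_ cc_pos.le
        have e1 : t ≤ Real.exp (t ^ 2 / 4) := by
          have := Real.add_one_le_exp (t ^ 2 / 4)
          nlinarith [sq_nonneg (t - 2)]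
        calc t * Real.exp (-t ^ 2 / 2) ≤ Real.exp (t ^ 2 / 4) * Real.exp (-t ^ 2 / 2) := by gcongr
          _ = Real.exp (-t ^ 2 / 4) := by rw [← Real.exp_add]; congr 1; ring
          _ ≤ _ := by
            apply Real.exp_le_exp.2
            have : A ^ 2 ≤ t ^ 2 := by gcongr
            linarith
    calc gd n (w - r • x) * ‖x‖ ≤ gd n (w - r • x) * (r⁻¹ * (‖w - r • x‖ + ‖w‖)) := by gcongr
      _ = r⁻¹ * (‖w - r • x‖ * gd n (w - r • x) + ‖w‖ * gd n (w - r • x)) := by ring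
      _ ≤ r⁻¹ * ((A * gd n (w - r • x) + cc n * Real.exp (-A ^ 2 / 4)) + ‖w‖ * gd n (w - r • x)) := by gcongr
      _ = _ := by ring
  have hint := G_int μ r w
  have h2 : ‖NN μ r w‖ ≤ r⁻¹ * ((A + ‖w‖) * DD μ r w + cc n * Real.exp (-A ^ 2 / 4)) := by
    refine (norm_integral_le_of_norm_le (((hint.const_mul _).add (integrable_const _)).const_mul _)
      (Filter.Eventually.of_forall hpt)).trans (le_of_eq ?_)
    simp only [Pi.add_apply]
    rw [integral_const_mul, integral_add (hint.const_mul _) (integrable_const _), integral_const_mul]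
    simp [DD]
  have h3 : cc n * Real.exp (-A ^ 2 / 4) ≤ DD μ r w := by
    refine le_trans (mul_le_mul_of_nonneg_left (Real.exp_le_exp.2 ?_) cc_pos.le) hD
    rw [hA]
    have : 0 ≤ (B - 1) * B * (1 + ‖w‖) ^ 2 := by
      have : 0 ≤ B - 1 := by linarith
      positivity
    nlinarith
  calc _ ≤ _ := h2
    _ ≤ r⁻¹ * ((A + ‖w‖) * DD μ r w + DD μ r w) := by gcongr
    _ = r⁻¹ * (A + ‖w‖ + 1) * DD μ r w := by ring
    _ ≤ r⁻¹ * (2 * B + 2) * (1 + ‖w‖) * DD μ r w := by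
      rw [mul_assoc r⁻¹ (2 * B + 2)]
      gcongr
      rw [hA]
      nlinarith [norm_nonneg w]

lemma hasDerivAt_gd_line (p q : EE) (s : ℝ) :
    HasDerivAt (fun s : ℝ => gd n (p + s • q)) (-⟪p + s • q, q⟫ * gd n (p + s • q)) s := by
  have h1 : HasDerivAt (fun s : ℝ => p + s • q) q s := by
    simpa using ((hasDerivAt_id s).smul_const q).const_add p
  have h2 := h1.norm_sq
  have h3 := ((h2.neg.div_const 2).exp).const_mul (cc n)
  refine HasDerivAt.congr_deriv h3 ?_
  rw [gd_eq]
  simp only [Pi.neg_apply]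
  ring

lemma hasDerivAt_int (μ : Measure EE) [IsProbabilityMeasure μ] (p q : EE → EE)
    (hp : Continuous p) (hq : Continuous q) (hqi : Integrable (fun x => ‖q x‖) μ) (s : ℝ) :
    HasDerivAt (fun s : ℝ => ∫ x, gd n (p x + s • q x) ∂μ)
      (∫ x, -⟪p x + s • q x, q x⟫ * gd n (p x + s • q x) ∂μ) s := by
  have hc : ∀ s : ℝ, Continuous fun x => gd n (p x + s • q x) := fun s => gd_cont.comp (by fun_prop)
  refine (hasDerivAt_integral_of_dominated_loc_of_deriv_le (bound := fun x => cc n * ‖q x‖)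
    (F := fun s x => gd n (p x + s • q x))
    (F' := fun s x => -⟪p x + s • q x, q x⟫ * gd n (p x + s • q x))
    Filter.univ_mem (Filter.Eventually.of_forall fun s => (hc s).aestronglyMeasurable)
    ?_ ?_ ?_ (hqi.const_mul _) ?_).2
  · refine (integrable_const (cc n)).mono' (hc s).aestronglyMeasurable
      (Filter.Eventually.of_forall fun x => ?_)
    rw [Real.norm_of_nonneg (gd_pos _).le]; exact gd_le _
  · have := hc s
    exact Continuous.aestronglyMeasurable (by fun_prop)
  · refine Filter.Eventually.of_forall fun x s _ => ?_
    rw [norm_mul, norm_neg, Real.norm_of_nonneg (gd_pos _).le]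
    have h1 := norm_inner_le_norm (𝕜 := ℝ) (p x + s • q x) (q x)
    have h2 := norm_mul_gd_le (p x + s • q x)
    have h3 := gd_pos (p x + s • q x)
    calc _ ≤ (‖p x + s • q x‖ * ‖q x‖) * gd n (p x + s • q x) := by gcongr
      _ = (‖p x + s • q x‖ * gd n (p x + s • q x)) * ‖q x‖ := by ring
      _ ≤ _ := by gcongr
  · exact Filter.Eventually.of_forall fun x s _ => hasDerivAt_gd_line _ _ _

noncomputable def DR (μ : Measure EE) (r : ℝ) (w : EE) : ℝ :=
  ∫ x, ⟪w - r • x, x⟫ * gd n (w - r • x) ∂μ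

lemma hasDerivAt_DD (μ : Measure EE) [IsProbabilityMeasure μ]
    (h1 : Integrable (fun x : EE => ‖x‖) μ) (w : EE) (r : ℝ) :
    HasDerivAt (fun r => DD μ r w) (DR μ r w) r := by
  have := hasDerivAt_int μ (fun _ => w) (fun x => -x) (by fun_prop) (by fun_prop) (by simpa using h1) r
  simpa [DR, DD, ← sub_eq_add_neg] using this

lemma hasLineDerivAt_DD (μ : Measure EE) [IsProbabilityMeasure μ]
    (h1 : Integrable (fun x : EE => ‖x‖) μ) (r : ℝ) (w v : EE) :
    HasLineDerivAt ℝ (DD μ r) (r * ⟪v, NN μ r w⟫ - ⟪v, w⟫ * DD μ r w) w v := by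
  have h := hasDerivAt_int μ (fun x => w - r • x) (fun x => v) (by fun_prop) (by fun_prop) (integrable_const _) 0
  unfold HasLineDerivAt
  have e : (fun t : ℝ => DD μ r (w + t • v)) = (fun s : ℝ => ∫ x, gd n ((w - r • x) + s • v) ∂μ) := by
    funext t; unfold DD; congr 1; funext x; congr 1; abel
  rw [e]
  refine h.congr_deriv ?_
  have h2 : Integrable (fun x => r * ⟪v, gd n (w - r • x) • x⟫) μ :=
    ((Gx_int μ h1 r w).const_inner v).const_mul r
  have h3 : Integrable (fun x => ⟪v, w⟫ * gd n (w - r • x)) μ := (G_int μ r w).const_mul _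
  unfold NN DD
  rw [← integral_inner (Gx_int μ h1 r w), ← integral_const_mul, ← integral_const_mul, ← integral_sub h2 h3]
  congr 1; funext x
  simp only [zero_smul, add_zero, real_inner_comm v, inner_sub_right, inner_smul_right]
  ring

lemma G_meas (r : ℝ) : Measurable (fun p : EE × EE => ENNReal.ofReal (gd n (p.2 - r • p.1))) :=
  (G_cont r).measurable.ennreal_ofReal

lemma DD_meas (μ : Measure EE) [IsProbabilityMeasure μ] (r : ℝ) :
    Measurable (fun w : EE => ENNReal.ofReal (DD μ r w)) := (DD_cont μ r).measurable.ennreal_ofReal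

lemma stdG_eq : stdGaussian n = volume.withDensity (fun w => ENNReal.ofReal (gd n w)) := rfl

instance : SFinite (stdGaussian n) := by rw [stdG_eq]; infer_instance

lemma lawXY_eq (μ : Measure EE) [IsProbabilityMeasure μ] (r : ℝ) :
    lawXY n r μ = (μ.prod volume).withDensity (fun p => ENNReal.ofReal (gd n (p.2 - r • p.1))) := by
  refine Measure.ext_of_lintegral _ fun f hf => ?_
  rw [lintegral_withDensity_eq_lintegral_mul _ (G_meas r) hf]
  unfold lawXY
  have hm : Measurable (fun p : EE × EE => (p.1, r • p.1 + p.2)) := by fun_prop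
  rw [lintegral_map hf hm]
  have hfm : Measurable (fun p : EE × EE => f (p.1, r • p.1 + p.2)) := hf.comp hm
  rw [lintegral_prod _ hfm.aemeasurable, lintegral_prod _ ((G_meas r).mul hf).aemeasurable]
  congr 1; funext x
  have hg : Measurable (fun w : EE => ENNReal.ofReal (gd n w)) := gd_cont.measurable.ennreal_ofReal
  have hfx : Measurable (fun w : EE => f (x, r • x + w)) := hf.comp (by fun_prop)
  rw [stdG_eq, lintegral_withDensity_eq_lintegral_mul _ hg hfx]
  simp only [Pi.mul_apply]
  rw [← lintegral_add_left_eq_self (fun w => ENNReal.ofReal (gd n (w - r • x)) * f (x, w)) (r • x)]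
  simp

lemma lawY_eq (μ : Measure EE) [IsProbabilityMeasure μ] (r : ℝ) :
    lawY n r μ = volume.withDensity (fun w => ENNReal.ofReal (DD μ r w)) := by
  have h1 : lawY n r μ = (lawXY n r μ).map Prod.snd := by
    unfold lawY lawXY
    rw [Measure.map_map measurable_snd (by fun_prop)]
    rfl
  rw [h1, lawXY_eq]
  refine Measure.ext_of_lintegral _ fun f hf => ?_
  have hf2 : Measurable (fun p : EE × EE => f p.2) := hf.comp measurable_snd
  rw [lintegral_map hf measurable_snd, lintegral_withDensity_eq_lintegral_mul _ (DD_meas μ r) hf,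
    lintegral_withDensity_eq_lintegral_mul _ (G_meas r) hf2,
    lintegral_prod_symm _ ((G_meas r).mul hf2).aemeasurable]
  congr 1; funext w
  simp only [Pi.mul_apply]
  rw [lintegral_mul_const _ ((G_cont_x r w).measurable.ennreal_ofReal)]
  congr 1
  unfold DD
  rw [ofReal_integral_eq_lintegral_ofReal (G_int μ r w) (Filter.Eventually.of_forall fun x => (gd_pos _).le)]

instance (μ : Measure EE) [IsProbabilityMeasure μ] (r : ℝ) : SigmaFinite (lawY n r μ) := by
  rw [lawY_eq]; exact SigmaFinite.withDensity_ofReal _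

lemma lawXY_eq' (μ : Measure EE) [IsProbabilityMeasure μ] (r : ℝ) :
    lawXY n r μ = (μ.prod (lawY n r μ)).withDensity
      (fun p => ENNReal.ofReal (gd n (p.2 - r • p.1) / DD μ r p.2)) := by
  rw [lawXY_eq]
  have hm : Measurable (fun p : EE × EE => ENNReal.ofReal (gd n (p.2 - r • p.1) / DD μ r p.2)) :=
    ((G_cont r).measurable.div ((DD_cont μ r).measurable.comp measurable_snd)).ennreal_ofReal
  refine Measure.ext_of_lintegral _ fun f hf => ?_
  rw [lintegral_withDensity_eq_lintegral_mul _ (G_meas r) hf,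
    lintegral_withDensity_eq_lintegral_mul _ hm hf,
    lintegral_prod _ ((G_meas r).mul hf).aemeasurable, lintegral_prod _ (hm.mul hf).aemeasurable]
  congr 1; funext x
  have hx : Measurable (fun w : EE => ENNReal.ofReal (gd n (w - r • x) / DD μ r w) * f (x, w)) :=
    ((G_cont_w r x).measurable.div (DD_cont μ r).measurable).ennreal_ofReal.mul
      (hf.comp (measurable_const.prodMk measurable_id))
  simp only [Pi.mul_apply]
  rw [lawY_eq, lintegral_withDensity_eq_lintegral_mul _ (DD_meas μ r) hx]
  congr 1; funext w
  simp only [Pi.mul_apply]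
  rw [← mul_assoc, ← ENNReal.ofReal_mul (DD_pos μ r w).le, mul_div_cancel₀ _ (DD_pos μ r w).ne']

lemma integral_lawXY (μ : Measure EE) [IsProbabilityMeasure μ] (r : ℝ) (f : EE × EE → ℝ) :
    ∫ p, f p ∂(lawXY n r μ) = ∫ p, gd n (p.2 - r • p.1) * f p ∂(μ.prod volume) := by
  rw [lawXY_eq, integral_withDensity_eq_integral_toReal_smul (G_meas r) (by simp)]
  congr 1; funext p
  rw [ENNReal.toReal_ofReal (gd_pos _).le, smul_eq_mul]

lemma integral_lawY (μ : Measure EE) [IsProbabilityMeasure μ] (r : ℝ) (f : EE → ℝ) :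
    ∫ p, f p ∂(lawY n r μ) = ∫ w, DD μ r w * f w := by
  rw [lawY_eq, integral_withDensity_eq_integral_toReal_smul (DD_meas μ r) (by simp)]
  congr 1; funext p
  rw [ENNReal.toReal_ofReal (DD_pos _ _ _).le, smul_eq_mul]

lemma mutualInfo_eq1 (μ : Measure EE) [IsProbabilityMeasure μ] (r : ℝ) :
    mutualInfo n r μ = ∫ p, gd n (p.2 - r • p.1) *
      (Real.log (gd n (p.2 - r • p.1)) - Real.log (DD μ r p.2)) ∂(μ.prod volume) := by
  rw [← integral_lawXY μ r (fun p => Real.log (gd n (p.2 - r • p.1)) - Real.log (DD μ r p.2))]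
  unfold mutualInfo
  have hm : Measurable (fun p : EE × EE => ENNReal.ofReal (gd n (p.2 - r • p.1) / DD μ r p.2)) :=
    ((G_cont r).measurable.div ((DD_cont μ r).measurable.comp measurable_snd)).ennreal_ofReal
  have h1 := Measure.rnDeriv_withDensity (μ.prod (lawY n r μ)) hm
  rw [← lawXY_eq'] at h1
  have hac : lawXY n r μ ≪ μ.prod (lawY n r μ) := by
    nth_rewrite 1 [lawXY_eq']
    exact withDensity_absolutelyContinuous _ _
  refine integral_congr_ae ?_
  filter_upwards [hac.ae_le h1] with p hp
  rw [hp, ENNReal.toReal_ofReal (div_pos (gd_pos _) (DD_pos μ r _)).le,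
    Real.log_div (gd_pos _).ne' (DD_pos μ r _).ne']

lemma norm_pow_le (x : EE) (k : ℕ) : ‖x‖ ^ k ≤ (1 + ‖x‖) ^ k := by
  gcongr; linarith

lemma one_le_w (x : EE) : 1 ≤ 1 + ‖x‖ := by linarith [norm_nonneg x]

lemma int_G_logG (μ : Measure EE) [IsProbabilityMeasure μ]
    (hm : ∀ K : ℕ, Integrable (fun x : EE => (1 + ‖x‖) ^ K) μ) (r : ℝ) :
    Integrable (fun p : EE × EE => gd n (p.2 - r • p.1) * Real.log (gd n (p.2 - r • p.1))) (μ.prod volume) := by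
  have hc : Continuous (fun p : EE × EE => gd n (p.2 - r • p.1) * Real.log (gd n (p.2 - r • p.1))) :=
    (G_cont r).mul ((G_cont r).log fun p => (gd_pos _).ne')
  refine integrable_prod_of_bound μ hm hc.aestronglyMeasurable r (|Real.log (cc n)| + (1 + |r|) ^ 2) 2 2 ?_
  intro x w
  simp only
  rw [abs_mul, abs_of_pos (gd_pos _), log_gd]
  have g0 := gd_pos (w - r • x)
  have hx := one_le_w x
  have hw := one_le_w w
  have h0 : ‖w - r • x‖ ≤ (1 + |r|) * ((1 + ‖x‖) * (1 + ‖w‖)) := by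
    refine (norm_sub_le _ _).trans ?_
    rw [norm_smul, Real.norm_eq_abs]
    have h1 := abs_nonneg r
    have h2 := norm_nonneg x
    have h3 := norm_nonneg w
    nlinarith [mul_nonneg h1 h2, mul_nonneg h1 h3, mul_nonneg h2 h3, mul_nonneg h1 (mul_nonneg h2 h3)]
  have h1 : ‖w - r • x‖ ^ 2 ≤ (1 + |r|) ^ 2 * ((1 + ‖x‖) ^ 2 * (1 + ‖w‖) ^ 2) := by
    rw [← mul_pow, ← mul_pow]; gcongr
  have h2 : 1 ≤ (1 + ‖x‖) ^ 2 * (1 + ‖w‖) ^ 2 := by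
    rw [← mul_pow]; exact one_le_pow₀ (one_le_mul_of_one_le_of_one_le hx hw)
  have h3 : |Real.log (cc n) - ‖w - r • x‖ ^ 2 / 2| ≤
      (|Real.log (cc n)| + (1 + |r|) ^ 2) * ((1 + ‖x‖) ^ 2 * (1 + ‖w‖) ^ 2) := by
    refine (abs_sub _ _).trans ?_
    rw [abs_of_nonneg (a := ‖w - r • x‖ ^ 2 / 2) (by positivity)]
    have := abs_nonneg (Real.log (cc n))
    nlinarith [sq_nonneg ‖w - r • x‖]
  calc _ ≤ gd n (w - r • x) * ((|Real.log (cc n)| + (1 + |r|) ^ 2) * ((1 + ‖x‖) ^ 2 * (1 + ‖w‖) ^ 2)) := by gcongr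
    _ = _ := by ring

lemma int_G_logD (μ : Measure EE) [IsProbabilityMeasure μ]
    (hm : ∀ K : ℕ, Integrable (fun x : EE => (1 + ‖x‖) ^ K) μ) (r : ℝ) :
    Integrable (fun p : EE × EE => gd n (p.2 - r • p.1) * Real.log (DD μ r p.2)) (μ.prod volume) := by
  have hc : Continuous (fun p : EE × EE => gd n (p.2 - r • p.1) * Real.log (DD μ r p.2)) :=
    (G_cont r).mul (((DD_cont μ r).comp continuous_snd).log fun p => (DD_pos _ _ _).ne')
  obtain ⟨B, hB, h⟩ := log_DD_bound μ |r|
  refine integrable_prod_of_bound μ hm hc.aestronglyMeasurable r B 0 2 ?_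
  intro x w
  simp only
  have g0 := gd_pos (w - r • x)
  have := h r le_rfl w
  rw [abs_mul, abs_of_pos (gd_pos _)]
  calc _ ≤ gd n (w - r • x) * (B * (1 + ‖w‖) ^ 2) := by gcongr
    _ = _ := by ring

lemma mutualInfo_eq (μ : Measure EE) [IsProbabilityMeasure μ]
    (hm : ∀ K : ℕ, Integrable (fun x : EE => (1 + ‖x‖) ^ K) μ) (r : ℝ) :
    mutualInfo n r μ = (∫ w, gd n w * Real.log (gd n w)) - ∫ w, DD μ r w * Real.log (DD μ r w) := by
  rw [mutualInfo_eq1]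
  simp_rw [mul_sub]
  rw [integral_sub (int_G_logG μ hm r) (int_G_logD μ hm r), integral_prod _ (int_G_logG μ hm r),
    integral_prod_symm _ (int_G_logD μ hm r)]
  congr 1
  · have : ∀ x : EE, ∫ w, gd n (w - r • x) * Real.log (gd n (w - r • x)) = ∫ w, gd n w * Real.log (gd n w) :=
      fun x => integral_sub_right_eq_self (fun w => gd n w * Real.log (gd n w)) (r • x)
    simp_rw [this]; simp
  · congr 1; funext w
    simp only
    rw [integral_mul_const]
    rfl

lemma int_G_mul (μ : Measure EE) [IsProbabilityMeasure μ]
    (hm : ∀ K : ℕ, Integrable (fun x : EE => (1 + ‖x‖) ^ K) μ) (r : ℝ) (f : EE × EE → ℝ)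
    (hf : Continuous f) (C : ℝ) (a b : ℕ)
    (hb : ∀ x w, |f (x, w)| ≤ C * ((1 + ‖x‖) ^ a * (1 + ‖w‖) ^ b)) :
    Integrable (fun p : EE × EE => gd n (p.2 - r • p.1) * f p) (μ.prod volume) := by
  refine integrable_prod_of_bound μ hm ((G_cont r).mul hf).aestronglyMeasurable r C a b ?_
  intro x w
  simp only
  have g0 := gd_pos (w - r • x)
  rw [abs_mul, abs_of_pos g0]
  calc _ ≤ gd n (w - r • x) * (C * ((1 + ‖x‖) ^ a * (1 + ‖w‖) ^ b)) := by gcongr; exact hb x w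
    _ = _ := by ring

lemma norm_sub_smul_le (r : ℝ) (x w : EE) :
    ‖w - r • x‖ ≤ (1 + |r|) * ((1 + ‖x‖) * (1 + ‖w‖)) := by
  refine (norm_sub_le _ _).trans ?_
  rw [norm_smul, Real.norm_eq_abs]
  have h1 := abs_nonneg r
  have h2 := norm_nonneg x
  have h3 := norm_nonneg w
  nlinarith [mul_nonneg h1 h2, mul_nonneg h1 h3, mul_nonneg h2 h3, mul_nonneg h1 (mul_nonneg h2 h3)]

lemma inner_bd (r : ℝ) (x w : EE) :
    |⟪w - r • x, x⟫| ≤ (1 + |r|) * ((1 + ‖x‖) ^ 2 * (1 + ‖w‖)) := by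
  have h1 := norm_sub_smul_le r x w
  calc _ ≤ ‖w - r • x‖ * ‖x‖ := abs_real_inner_le_norm _ _
    _ ≤ ((1 + |r|) * ((1 + ‖x‖) * (1 + ‖w‖))) * (1 + ‖x‖) := by gcongr; linarith
    _ = _ := by ring

lemma DR_bound (μ : Measure EE) [IsProbabilityMeasure μ]
    (hm : ∀ K : ℕ, Integrable (fun x : EE => (1 + ‖x‖) ^ K) μ) (R : ℝ) (hR : 0 ≤ R) (K : ℕ) :
    ∃ C, 0 ≤ C ∧ ∀ r, |r| ≤ R → ∀ w : EE, (1 + ‖w‖) ^ K * |DR μ r w| ≤ C := by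
  obtain ⟨P, hP, h⟩ := peetre (n := n) R hR (K + 1)
  refine ⟨∫ x, (1 + R) * P * (1 + ‖x‖) ^ (K + 3) ∂μ, integral_nonneg fun x => by positivity, ?_⟩
  intro r hr w
  have e : (1 + ‖w‖) ^ K * |DR μ r w| = ‖∫ x, (1 + ‖w‖) ^ K * (⟪w - r • x, x⟫ * gd n (w - r • x)) ∂μ‖ := by
    rw [integral_const_mul, norm_mul, Real.norm_of_nonneg (by positivity), Real.norm_eq_abs]; rfl
  rw [e]
  refine norm_integral_le_of_norm_le ((hm _).const_mul _) (Filter.Eventually.of_forall fun x => ?_)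
  have g0 := gd_pos (w - r • x)
  rw [norm_mul, norm_mul, Real.norm_of_nonneg (r := (1 + ‖w‖) ^ K) (by positivity), Real.norm_of_nonneg g0.le,
    Real.norm_eq_abs]
  have h1 := inner_bd r x w
  calc _ ≤ (1 + ‖w‖) ^ K * (((1 + |r|) * ((1 + ‖x‖) ^ 2 * (1 + ‖w‖))) * gd n (w - r • x)) := by gcongr
    _ = (1 + |r|) * (1 + ‖x‖) ^ 2 * ((1 + ‖w‖) ^ (K + 1) * gd n (w - r • x)) := by ring
    _ ≤ (1 + R) * (1 + ‖x‖) ^ 2 * (P * (1 + ‖x‖) ^ (K + 1)) := by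
        have := h r hr x w
        gcongr
    _ = _ := by ring

lemma deriv_H (μ : Measure EE) [IsProbabilityMeasure μ]
    (hm : ∀ K : ℕ, Integrable (fun x : EE => (1 + ‖x‖) ^ K) μ)
    (h1 : Integrable (fun x : EE => ‖x‖) μ) (ρ : ℝ) :
    HasDerivAt (fun r => ∫ w, DD μ r w * Real.log (DD μ r w))
      (∫ w, DR μ ρ w * (Real.log (DD μ ρ w) + 1)) ρ := by
  obtain ⟨C, hC, hCb⟩ := DR_bound μ hm (|ρ| + 1) (by positivity) (n + 3)
  obtain ⟨B, hB, hBb⟩ := log_DD_bound μ (|ρ| + 1)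
  have hlogc : ∀ r, Continuous (fun w => Real.log (DD μ r w)) := fun r =>
    (DD_cont μ r).log fun w => (DD_pos μ r w).ne'
  refine (hasDerivAt_integral_of_dominated_loc_of_deriv_le
    (bound := fun w => C * (B + 1) * ((1 + ‖w‖) ^ (n + 1))⁻¹)
    (F := fun r w => DD μ r w * Real.log (DD μ r w))
    (F' := fun r w => DR μ r w * (Real.log (DD μ r w) + 1))
    (Metric.ball_mem_nhds ρ one_pos)
    (Filter.Eventually.of_forall fun r => ((DD_cont μ r).mul (hlogc r)).aestronglyMeasurable)
    ?_ ?_ ?_ (integrable_weight.const_mul _) ?_).2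
  · have := (int_G_logD μ hm ρ).integral_prod_right
    refine this.congr (Filter.Eventually.of_forall fun w => ?_)
    simp only
    rw [integral_mul_const]; rfl
  · have hs : StronglyMeasurable (DR μ ρ) := by
      unfold DR
      refine StronglyMeasurable.integral_prod_right (f := fun w x => ⟪w - ρ • x, x⟫ * gd n (w - ρ • x)) ?_
      refine Continuous.stronglyMeasurable ?_
      refine Continuous.mul (by fun_prop) (gd_cont.comp (by fun_prop))
    exact hs.aestronglyMeasurable.mul ((hlogc ρ).add continuous_const).aestronglyMeasurable
  · refine Filter.Eventually.of_forall fun w r hr => ?_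
    have hr' : |r| ≤ |ρ| + 1 := by
      rw [Metric.mem_ball, Real.dist_eq] at hr
      have := abs_sub_abs_le_abs_sub r ρ
      linarith
    have e1 := hCb r hr' w
    have e2 := hBb r hr' w
    have e3 : 1 ≤ (1 + ‖w‖) ^ 2 := one_le_pow₀ (one_le_w w)
    have e4 : |Real.log (DD μ r w) + 1| ≤ (B + 1) * (1 + ‖w‖) ^ 2 := by
      refine (abs_add_le _ _).trans ?_
      rw [abs_one]; linarith
    rw [norm_mul, Real.norm_eq_abs, Real.norm_eq_abs, ← div_eq_mul_inv, le_div_iff₀ (by positivity)]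
    calc _ ≤ |DR μ r w| * ((B + 1) * (1 + ‖w‖) ^ 2) * (1 + ‖w‖) ^ (n + 1) := by gcongr
      _ = ((1 + ‖w‖) ^ (n + 3) * |DR μ r w|) * (B + 1) := by ring
      _ ≤ _ := by gcongr
  · refine Filter.Eventually.of_forall fun w r _ => ?_
    have hd := hasDerivAt_DD μ h1 w r
    have hp := (DD_pos μ r w).ne'
    refine (hd.mul (hd.log hp)).congr_deriv ?_
    field_simp

noncomputable def PM (μ : Measure EE) (r : ℝ) (w : EE) : EE := (DD μ r w)⁻¹ • NN μ r w

lemma postMean_eq (μ : Measure EE) (r : ℝ) (w : EE) : postMean n r μ w = PM μ r w := by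
  have h : ∀ x : EE, gd n (w - r • x) = gd n w * Real.exp (r * ⟪w, x⟫ - r ^ 2 / 2 * ‖x‖ ^ 2) := by
    intro x
    rw [gd_eq, gd_eq, mul_assoc, ← Real.exp_add]
    congr 2
    rw [norm_sub_sq_real, norm_smul, inner_smul_right, mul_pow, Real.norm_eq_abs, sq_abs]
    ring
  unfold postMean PM lik DD NN
  simp_rw [h, mul_smul]
  rw [integral_const_mul, integral_smul, mul_inv, smul_smul]
  congr 1
  rw [mul_assoc, mul_comm, mul_assoc, mul_inv_cancel₀ (gd_pos w).ne', mul_one]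

lemma PM_cont (μ : Measure EE) [IsProbabilityMeasure μ]
    (h1 : Integrable (fun x : EE => ‖x‖) μ) (r : ℝ) : Continuous (PM μ r) :=
  ((DD_cont μ r).inv₀ fun w => (DD_pos μ r w).ne').smul (NN_cont μ h1 r)

lemma PM_bound (μ : Measure EE) [IsProbabilityMeasure μ] (r : ℝ) (hr : 0 < r) :
    ∃ C, 0 ≤ C ∧ ∀ w : EE, ‖PM μ r w‖ ≤ C * (1 + ‖w‖) := by
  obtain ⟨C, hC, h⟩ := NN_bound μ r hr
  refine ⟨C, hC, fun w => ?_⟩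
  have hp := DD_pos μ r w
  unfold PM
  rw [norm_smul, Real.norm_of_nonneg (inv_pos.2 hp).le, ← div_eq_inv_mul, div_le_iff₀ hp]
  exact h w

lemma int_xm (μ : Measure EE) [IsProbabilityMeasure μ]
    (hm : ∀ K : ℕ, Integrable (fun x : EE => (1 + ‖x‖) ^ K) μ)
    (h1 : Integrable (fun x : EE => ‖x‖) μ) (r : ℝ) (hr : 0 < r) :
    Integrable (fun p : EE × EE => gd n (p.2 - r • p.1) * ⟪p.1, PM μ r p.2⟫) (μ.prod volume) := by
  obtain ⟨C, hC, h⟩ := PM_bound μ r hr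
  have hc := PM_cont μ h1 r
  refine int_G_mul μ hm r (fun p => ⟪p.1, PM μ r p.2⟫) (by fun_prop) C 1 1 fun x w => ?_
  have := h w
  simp only [pow_one]
  calc _ ≤ ‖x‖ * ‖PM μ r w‖ := abs_real_inner_le_norm _ _
    _ ≤ (1 + ‖x‖) * (C * (1 + ‖w‖)) := by gcongr; linarith
    _ = _ := by ring

lemma int_mm (μ : Measure EE) [IsProbabilityMeasure μ]
    (hm : ∀ K : ℕ, Integrable (fun x : EE => (1 + ‖x‖) ^ K) μ)
    (h1 : Integrable (fun x : EE => ‖x‖) μ) (r : ℝ) (hr : 0 < r) :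
    Integrable (fun p : EE × EE => gd n (p.2 - r • p.1) * ‖PM μ r p.2‖ ^ 2) (μ.prod volume) := by
  obtain ⟨C, hC, h⟩ := PM_bound μ r hr
  have hc := PM_cont μ h1 r
  refine int_G_mul μ hm r (fun p => ‖PM μ r p.2‖ ^ 2) (by fun_prop) (C ^ 2) 0 2 fun x w => ?_
  have := h w
  simp only [pow_zero, one_mul]
  rw [abs_of_nonneg (by positivity), ← mul_pow]
  gcongr

lemma int_xx (μ : Measure EE) [IsProbabilityMeasure μ]
    (hm : ∀ K : ℕ, Integrable (fun x : EE => (1 + ‖x‖) ^ K) μ) (r : ℝ) :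
    Integrable (fun p : EE × EE => gd n (p.2 - r • p.1) * ‖p.1‖ ^ 2) (μ.prod volume) := by
  refine int_G_mul μ hm r (fun p => ‖p.1‖ ^ 2) (by fun_prop) 1 2 0 fun x w => ?_
  simp only [pow_zero, one_mul, mul_one]
  rw [abs_of_nonneg (by positivity)]
  exact norm_pow_le x 2

lemma int_xw (μ : Measure EE) [IsProbabilityMeasure μ]
    (hm : ∀ K : ℕ, Integrable (fun x : EE => (1 + ‖x‖) ^ K) μ) (r : ℝ) :
    Integrable (fun p : EE × EE => gd n (p.2 - r • p.1) * ⟪p.1, p.2⟫) (μ.prod volume) := by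
  refine int_G_mul μ hm r (fun p => ⟪p.1, p.2⟫) (by fun_prop) 1 1 1 fun x w => ?_
  simp only [pow_one, one_mul]
  refine (abs_real_inner_le_norm _ _).trans ?_
  gcongr <;> linarith

lemma int_log1 (μ : Measure EE) [IsProbabilityMeasure μ]
    (hm : ∀ K : ℕ, Integrable (fun x : EE => (1 + ‖x‖) ^ K) μ) (r : ℝ) :
    Integrable (fun p : EE × EE => gd n (p.2 - r • p.1) * (Real.log (DD μ r p.2) + 1)) (μ.prod volume) ∧
    Integrable (fun p : EE × EE => gd n (p.2 - r • p.1) *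
      (⟪p.2 - r • p.1, p.1⟫ * (Real.log (DD μ r p.2) + 1))) (μ.prod volume) := by
  obtain ⟨B, hB, hBb⟩ := log_DD_bound μ |r|
  have hlogc : Continuous (fun p : EE × EE => Real.log (DD μ r p.2) + 1) :=
    (((DD_cont μ r).comp continuous_snd).log fun w => (DD_pos μ r _).ne').add continuous_const
  have e4 : ∀ w : EE, |Real.log (DD μ r w) + 1| ≤ (B + 1) * (1 + ‖w‖) ^ 2 := by
    intro w
    refine (abs_add_le _ _).trans ?_
    have e3 : 1 ≤ (1 + ‖w‖) ^ 2 := one_le_pow₀ (one_le_w w)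
    have := hBb r le_rfl w
    rw [abs_one]; linarith
  constructor
  · refine int_G_mul μ hm r _ hlogc (B + 1) 0 2 fun x w => ?_
    simpa using e4 w
  · refine int_G_mul μ hm r _ (Continuous.mul (by fun_prop) hlogc) ((1 + |r|) * (B + 1)) 2 3 fun x w => ?_
    simp only
    rw [abs_mul]
    have h1 := inner_bd r x w
    have h2 := e4 w
    calc _ ≤ ((1 + |r|) * ((1 + ‖x‖) ^ 2 * (1 + ‖w‖))) * ((B + 1) * (1 + ‖w‖) ^ 2) := by gcongr
      _ = _ := by ring

lemma eq_xm (μ : Measure EE) [IsProbabilityMeasure μ]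
    (hm : ∀ K : ℕ, Integrable (fun x : EE => (1 + ‖x‖) ^ K) μ)
    (h1 : Integrable (fun x : EE => ‖x‖) μ) (r : ℝ) (hr : 0 < r) :
    ∫ p : EE × EE, gd n (p.2 - r • p.1) * ⟪p.1, PM μ r p.2⟫ ∂(μ.prod volume) =
      ∫ w, DD μ r w * ‖PM μ r w‖ ^ 2 := by
  rw [integral_prod_symm _ (int_xm μ hm h1 r hr)]
  congr 1; funext w
  simp only
  have e : ∀ x : EE, gd n (w - r • x) * ⟪x, PM μ r w⟫ = ⟪PM μ r w, gd n (w - r • x) • x⟫ := by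
    intro x; rw [inner_smul_right, real_inner_comm]
  simp_rw [e]
  rw [integral_inner (Gx_int μ h1 r w)]
  have : NN μ r w = DD μ r w • PM μ r w := by
    unfold PM; rw [smul_smul, mul_inv_cancel₀ (DD_pos μ r w).ne', one_smul]
  change ⟪PM μ r w, NN μ r w⟫ = _
  rw [this]
  rw [inner_smul_right, real_inner_self_eq_norm_sq]

lemma eq_mm (μ : Measure EE) [IsProbabilityMeasure μ]
    (hm : ∀ K : ℕ, Integrable (fun x : EE => (1 + ‖x‖) ^ K) μ)
    (h1 : Integrable (fun x : EE => ‖x‖) μ) (r : ℝ) (hr : 0 < r) :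
    ∫ p : EE × EE, gd n (p.2 - r • p.1) * ‖PM μ r p.2‖ ^ 2 ∂(μ.prod volume) =
      ∫ w, DD μ r w * ‖PM μ r w‖ ^ 2 := by
  rw [integral_prod_symm _ (int_mm μ hm h1 r hr)]
  congr 1; funext w
  simp only
  rw [integral_mul_const]; rfl

lemma eq_xx (μ : Measure EE) [IsProbabilityMeasure μ]
    (hm : ∀ K : ℕ, Integrable (fun x : EE => (1 + ‖x‖) ^ K) μ) (r : ℝ) :
    ∫ p : EE × EE, gd n (p.2 - r • p.1) * ‖p.1‖ ^ 2 ∂(μ.prod volume) = ∫ x, ‖x‖ ^ 2 ∂μ := by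
  rw [integral_prod _ (int_xx μ hm r)]
  congr 1; funext x
  simp only
  rw [integral_mul_const, integral_sub_right_eq_self (fun w => gd n w) (r • x), gd_integral, one_mul]

lemma eq_xw (μ : Measure EE) [IsProbabilityMeasure μ]
    (hm : ∀ K : ℕ, Integrable (fun x : EE => (1 + ‖x‖) ^ K) μ) (r : ℝ) :
    ∫ p : EE × EE, gd n (p.2 - r • p.1) * ⟪p.1, p.2⟫ ∂(μ.prod volume) = r * ∫ x, ‖x‖ ^ 2 ∂μ := by
  rw [integral_prod _ (int_xw μ hm r), ← integral_const_mul]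
  congr 1; funext x
  simp only
  rw [← integral_add_right_eq_self (fun w => gd n (w - r • x) * ⟪x, w⟫) (r • x)]
  simp only [add_sub_cancel_right, inner_add_right, inner_smul_right, real_inner_self_eq_norm_sq, mul_add]
  have hg : Integrable (gd n) volume := by
    by_contra hc
    have := gd_integral (n := n)
    rw [integral_undef hc] at this
    exact zero_ne_one this
  have hi : Integrable (fun v : EE => gd n v * ⟪x, v⟫) volume := by
    refine ((integrable_weight (n := n)).const_mul (‖x‖ * (cc n * ((n + 2).factorial * Real.exp 2)))).mono'
      (gd_cont.mul (by fun_prop)).aestronglyMeasurable (Filter.Eventually.of_forall fun v => ?_)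
    have g0 := gd_pos v
    have h2 := pow_mul_gd_le (n + 2) v
    rw [norm_mul, Real.norm_of_nonneg g0.le, ← div_eq_mul_inv, le_div_iff₀ (by positivity)]
    calc _ ≤ gd n v * (‖x‖ * (1 + ‖v‖)) * (1 + ‖v‖) ^ (n + 1) := by
            have := norm_inner_le_norm (𝕜 := ℝ) x v
            gcongr
            refine this.trans ?_
            gcongr; linarith
      _ = ‖x‖ * ((1 + ‖v‖) ^ (n + 2) * gd n v) := by ring
      _ ≤ _ := by gcongr
  rw [integral_add hi (hg.mul_const _), integral_mul_const, gd_integral]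
  have hodd : ∫ v : EE, gd n v * ⟪x, v⟫ = 0 := by
    have h := integral_neg_eq_self (fun v : EE => gd n v * ⟪x, v⟫) volume
    simp only [gd_neg, inner_neg_right, mul_neg, integral_neg] at h
    linarith
  rw [hodd]; ring

lemma ibp (μ : Measure EE) [IsProbabilityMeasure μ]
    (hm : ∀ K : ℕ, Integrable (fun x : EE => (1 + ‖x‖) ^ K) μ)
    (h1 : Integrable (fun x : EE => ‖x‖) μ) (r : ℝ) (hr : 0 < r) :
    ∫ w, DR μ r w * (Real.log (DD μ r w) + 1) =
      r * (∫ w, DD μ r w * ‖PM μ r w‖ ^ 2) - r * ∫ x, ‖x‖ ^ 2 ∂μ := by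
  obtain ⟨iA, iB⟩ := int_log1 μ hm r
  have iC : Integrable (fun p : EE × EE => gd n (p.2 - r • p.1) * (r * ⟪p.1, PM μ r p.2⟫ - ⟪p.1, p.2⟫))
      (μ.prod volume) := by
    refine (((int_xm μ hm h1 r hr).const_mul r).sub (int_xw μ hm r)).congr
      (Filter.Eventually.of_forall fun p => ?_)
    simp only [Pi.sub_apply]; ring
  have e1 : ∫ w, DR μ r w * (Real.log (DD μ r w) + 1) = ∫ p : EE × EE, gd n (p.2 - r • p.1) *
      (⟪p.2 - r • p.1, p.1⟫ * (Real.log (DD μ r p.2) + 1)) ∂(μ.prod volume) := by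
    rw [integral_prod_symm _ iB]
    congr 1; funext w
    simp only
    unfold DR
    rw [← integral_mul_const]
    congr 1; funext x; ring
  have e2 : ∫ p : EE × EE, gd n (p.2 - r • p.1) *
      (⟪p.2 - r • p.1, p.1⟫ * (Real.log (DD μ r p.2) + 1)) ∂(μ.prod volume) =
      ∫ p : EE × EE, gd n (p.2 - r • p.1) * (r * ⟪p.1, PM μ r p.2⟫ - ⟪p.1, p.2⟫) ∂(μ.prod volume) := by
    rw [integral_prod _ iB, integral_prod _ iC]
    refine integral_congr_ae ?_
    filter_upwards [iA.prod_right_ae, iB.prod_right_ae, iC.prod_right_ae] with x jA jB jC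
    have key := integral_bilinear_hasLineDerivAt_right_eq_neg_left_of_integrable (μ := volume)
      (B := ContinuousLinearMap.mul ℝ ℝ) (v := x)
      (f := fun w : EE => gd n (w - r • x)) (f' := fun w => -⟪w - r • x, x⟫ * gd n (w - r • x))
      (g := fun w => Real.log (DD μ r w) + 1) (g' := fun w => r * ⟪x, PM μ r w⟫ - ⟪x, w⟫)
      (by
        refine jB.neg.congr (Filter.Eventually.of_forall fun w => ?_)
        simp only [ContinuousLinearMap.mul_apply', Pi.neg_apply]; ring)
      (by simpa only [ContinuousLinearMap.mul_apply'] using jC)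
      (by simpa only [ContinuousLinearMap.mul_apply'] using jA)
      (by
        intro w _
        have h := hasDerivAt_gd_line (w - r • x) x 0
        unfold HasLineDerivAt
        have e : (fun t : ℝ => gd n (w + t • x - r • x)) = fun s : ℝ => gd n (w - r • x + s • x) := by
          funext t; congr 1; abel
        rw [e]
        simpa using h)
      (by
        intro w _
        have h := hasLineDerivAt_DD μ h1 r w x
        unfold HasLineDerivAt at h ⊢
        have hp := (DD_pos μ r w).ne'
        have h2 := (h.log (by simpa using hp)).add_const 1
        refine h2.congr_deriv ?_
        simp only [zero_smul, add_zero]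
        unfold PM
        rw [inner_smul_right]
        field_simp)
    simp only [ContinuousLinearMap.mul_apply'] at key
    refine Eq.trans ?_ key.symm
    rw [← integral_neg]
    congr 1; funext w; ring
  rw [e1, e2]
  simp_rw [mul_sub, mul_left_comm _ r]
  rw [integral_sub ((int_xm μ hm h1 r hr).const_mul r) (int_xw μ hm r), integral_const_mul,
    eq_xm μ hm h1 r hr, eq_xw μ hm r]

lemma mmse (μ : Measure EE) [IsProbabilityMeasure μ]
    (hm : ∀ K : ℕ, Integrable (fun x : EE => (1 + ‖x‖) ^ K) μ)
    (h1 : Integrable (fun x : EE => ‖x‖) μ) (r : ℝ) (hr : 0 < r) :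
    ∫ p, ‖p.1 - postMean n r μ p.2‖ ^ 2 ∂(lawXY n r μ) =
      (∫ x, ‖x‖ ^ 2 ∂μ) - ∫ w, DD μ r w * ‖PM μ r w‖ ^ 2 := by
  rw [integral_lawXY]
  simp_rw [postMean_eq]
  have e : ∀ p : EE × EE, gd n (p.2 - r • p.1) * ‖p.1 - PM μ r p.2‖ ^ 2 =
      (gd n (p.2 - r • p.1) * ‖p.1‖ ^ 2 - 2 * (gd n (p.2 - r • p.1) * ⟪p.1, PM μ r p.2⟫)) +
        gd n (p.2 - r • p.1) * ‖PM μ r p.2‖ ^ 2 := by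
    intro p; rw [norm_sub_sq_real]; ring
  simp_rw [e]
  have ia := int_xx μ hm r
  have ib := (int_xm μ hm h1 r hr).const_mul 2
  have iab : Integrable (fun p : EE × EE => gd n (p.2 - r • p.1) * ‖p.1‖ ^ 2 -
      2 * (gd n (p.2 - r • p.1) * ⟪p.1, PM μ r p.2⟫)) (μ.prod volume) := ia.sub ib
  rw [integral_add iab (int_mm μ hm h1 r hr), integral_sub ia ib, integral_const_mul,
    eq_xx μ hm r, eq_xm μ hm h1 r hr, eq_mm μ hm h1 r hr]
  ring

end GSV

/-- I-MMSE / GSV: dI/dρ = ρ E|x − E[x|y]|² = ρ(E|x|² − E₁|E[x|y]|²). -/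
theorem GSV_I_MMSE (n : ℕ) (ρ : ℝ) (hρ : 0 < ρ)
    (μX : Measure (EuclideanSpace ℝ (Fin n))) [IsProbabilityMeasure μX]
    (hexp : ∀ (α : ℝ) (h : EuclideanSpace ℝ (Fin n)),
      Integrable (fun x => Real.exp (α * ⟪x, h⟫)) μX) :
    HasDerivAt (fun r => mutualInfo n r μX)
      (ρ * ∫ p, ‖p.1 - postMean n ρ μX p.2‖ ^ 2 ∂(lawXY n ρ μX)) ρ ∧
    ρ * ∫ p, ‖p.1 - postMean n ρ μX p.2‖ ^ 2 ∂(lawXY n ρ μX)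
      = ρ * ((∫ x, ‖x‖ ^ 2 ∂μX) - ∫ u, ‖postMean n ρ μX u‖ ^ 2 ∂(lawY n ρ μX)) := by
  have hm : ∀ K : ℕ, Integrable (fun x : EuclideanSpace ℝ (Fin n) => (1 + ‖x‖) ^ K) μX :=
    fun K => GSV.moments μX hexp K
  have h1 : Integrable (fun x : EuclideanSpace ℝ (Fin n) => ‖x‖) μX := by
    refine (hm 1).mono' (by fun_prop) (Filter.Eventually.of_forall fun x => ?_)
    rw [norm_norm, pow_one]; linarith
  have hM := GSV.mmse μX hm h1 ρ hρ
  constructor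
  · have hd := (GSV.deriv_H μX hm h1 ρ).const_sub (∫ w, GSV.gd n w * Real.log (GSV.gd n w))
    have e : (fun r => mutualInfo n r μX) = fun r => (∫ w, GSV.gd n w * Real.log (GSV.gd n w)) -
        ∫ w, GSV.DD μX r w * Real.log (GSV.DD μX r w) := by
      funext r; exact GSV.mutualInfo_eq μX hm r
    rw [e]
    refine hd.congr_deriv ?_
    rw [GSV.ibp μX hm h1 ρ hρ, hM]
    ring
  · rw [hM, GSV.integral_lawY]
    simp_rw [GSV.postMean_eq]
end

section
/- In the additive Gaussian channel y = ρx + w, the ρ-derivative of the relative entropy of μ_Y with respect to the standard Gaussian satisfies (d/dρ) E₁[log ℓ] = ρ E₁|E[x|y]|² = (1/ρ) E₁|∇ log ℓ|². (Extended de Bruijn identity.) -/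
open MeasureTheory Real
open scoped RealInnerProductSpace ENNReal

abbrev dbE (n : ℕ) := EuclideanSpace ℝ (Fin n)

noncomputable def dbK {n : ℕ} (r : ℝ) (u x : dbE n) : ℝ :=
  Real.exp (r * ⟪u, x⟫ - r ^ 2 / 2 * ‖x‖ ^ 2)

lemma dbK_pos {n : ℕ} (r : ℝ) (u x : dbE n) : 0 < dbK r u x := Real.exp_pos _

lemma dbK_eq {n : ℕ} (r : ℝ) (u x : dbE n) :
    dbK r u x = Real.exp (‖u‖ ^ 2 / 2) * Real.exp (-‖u - r • x‖ ^ 2 / 2) := by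
  unfold dbK
  rw [← Real.exp_add]
  congr 1
  rw [norm_sub_sq_real, inner_smul_right, norm_smul, mul_pow, Real.norm_eq_abs, sq_abs]
  ring

lemma dbK_le {n : ℕ} (r : ℝ) (u x : dbE n) : dbK r u x ≤ Real.exp (‖u‖ ^ 2 / 2) := by
  rw [dbK_eq]
  have : Real.exp (-‖u - r • x‖ ^ 2 / 2) ≤ 1 := by
    rw [Real.exp_le_one_iff]
    have := sq_nonneg ‖u - r • x‖
    linarith
  have h2 := Real.exp_pos (‖u‖ ^ 2 / 2)
  nlinarith

lemma dbK_cont {n : ℕ} (r : ℝ) : Continuous (fun p : dbE n × dbE n => dbK r p.2 p.1) := by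
  unfold dbK
  fun_prop

lemma dbK_cont1 {n : ℕ} (r : ℝ) (u : dbE n) : Continuous (fun x : dbE n => dbK r u x) := by
  unfold dbK
  fun_prop

lemma db_lik {n : ℕ} (r : ℝ) (μ : Measure (dbE n)) (u : dbE n) :
    lik n r μ u = ∫ x, dbK r u x ∂μ := rfl

lemma db_postMean {n : ℕ} (r : ℝ) (μ : Measure (dbE n)) (u : dbE n) :
    postMean n r μ u = (lik n r μ u)⁻¹ • ∫ x, dbK r u x • x ∂μ := rfl

/-- second moments -/
lemma db_sq {n : ℕ} (μX : Measure (dbE n))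
    (hexp : ∀ (α : ℝ) (h : dbE n), Integrable (fun x => Real.exp (α * ⟪x, h⟫)) μX) :
    Integrable (fun x => ‖x‖ ^ 2) μX := by
  have key : ∀ i : Fin n, Integrable (fun x : dbE n => (x i) ^ 2) μX := by
    intro i
    have h1 := hexp 1 (EuclideanSpace.single i 1)
    have h2 := hexp (-1) (EuclideanSpace.single i 1)
    refine ((h1.add h2).const_mul 2).mono' (by fun_prop) ?_
    refine Filter.Eventually.of_forall fun x => ?_
    have e : ⟪x, EuclideanSpace.single i (1 : ℝ)⟫ = x i := by
      rw [EuclideanSpace.inner_single_right]; simp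
    simp only [Pi.add_apply, e]
    rw [Real.norm_eq_abs, abs_of_nonneg (sq_nonneg _)]
    have a1 := Real.quadratic_le_exp_of_nonneg (abs_nonneg (x i))
    rw [sq_abs] at a1
    have a0 := abs_nonneg (x i)
    rcases abs_cases (x i) with ⟨h, _⟩ | ⟨h, _⟩
    · have := Real.exp_pos (-1 * x i)
      rw [h] at a1 a0
      rw [one_mul]; linarith
    · have := Real.exp_pos (1 * x i)
      rw [h] at a1 a0
      rw [neg_one_mul]; linarith
  have : (fun x : dbE n => ‖x‖ ^ 2) = fun x => ∑ i, (x i) ^ 2 := by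
    ext x; rw [EuclideanSpace.norm_sq_eq]; simp
  rw [this]
  exact integrable_finsetSum _ fun i _ => key i

noncomputable def dbphi {n : ℕ} (w : dbE n) : ℝ :=
  (2 * π) ^ (-(n : ℝ) / 2) * Real.exp (-‖w‖ ^ 2 / 2)

lemma dbphi_nonneg {n : ℕ} (w : dbE n) : 0 ≤ dbphi w := by unfold dbphi; positivity

lemma dbphi_cont {n : ℕ} : Continuous (dbphi (n := n)) := by unfold dbphi; fun_prop

lemma db_std {n : ℕ} : stdGaussian n = volume.withDensity (fun w => ENNReal.ofReal (dbphi w)) := rfl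

lemma db_gauss_int {n : ℕ} {b : ℝ} (hb : 0 < b) :
    Integrable (fun w : dbE n => Real.exp (-b * ‖w‖ ^ 2)) := by
  have h := GaussianFourier.integral_rexp_neg_mul_sq_norm (V := dbE n) hb
  by_contra hc
  rw [integral_undef hc] at h
  have : 0 < (π / b) ^ (Module.finrank ℝ (dbE n) / 2 : ℝ) := by positivity
  linarith

lemma db_std_int {n : ℕ} {f : dbE n → ℝ} :
    Integrable f (stdGaussian n) ↔ Integrable (fun w => dbphi w * f w) := by
  rw [db_std, integrable_withDensity_iff_integrable_smul' (by have := dbphi_cont (n := n); fun_prop)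
    (Filter.Eventually.of_forall fun x => ENNReal.ofReal_lt_top)]
  simp only [ENNReal.toReal_ofReal (dbphi_nonneg _), smul_eq_mul]

lemma db_std_integral {n : ℕ} (f : dbE n → ℝ) :
    ∫ w, f w ∂(stdGaussian n) = ∫ w, dbphi w * f w := by
  rw [db_std, integral_withDensity_eq_integral_toReal_smul
    (by have := dbphi_cont (n := n); fun_prop)
    (Filter.Eventually.of_forall fun x => ENNReal.ofReal_lt_top)]
  simp only [ENNReal.toReal_ofReal (dbphi_nonneg _), smul_eq_mul]

instance db_fin (n : ℕ) : IsFiniteMeasure (stdGaussian n) := by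
  have h : Integrable (fun _ : dbE n => (1 : ℝ)) (stdGaussian n) := by
    rw [db_std_int]
    have := (db_gauss_int (n := n) (b := 1 / 2) (by norm_num)).const_mul ((2 * π) ^ (-(n : ℝ) / 2))
    refine this.congr (Filter.Eventually.of_forall fun w => ?_)
    simp only [dbphi, mul_one]
    ring_nf
  rcases (integrable_const_iff.1 h) with h | h
  · norm_num at h
  · exact h

lemma db_std_sq (n : ℕ) : Integrable (fun w : dbE n => ‖w‖ ^ 2) (stdGaussian n) := by
  rw [db_std_int]
  have := (db_gauss_int (n := n) (b := 1 / 4) (by norm_num)).const_mul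
    ((2 * π) ^ (-(n : ℝ) / 2) * 4)
  refine this.mono' (by have := dbphi_cont (n := n); fun_prop) ?_
  refine Filter.Eventually.of_forall fun w => ?_
  rw [Real.norm_eq_abs, abs_of_nonneg (mul_nonneg (dbphi_nonneg _) (sq_nonneg _))]
  unfold dbphi
  rw [mul_assoc, mul_assoc]
  refine mul_le_mul_of_nonneg_left ?_ (by positivity)
  have e : Real.exp (-‖w‖ ^ 2 / 2) = Real.exp (-(1/4) * ‖w‖ ^ 2) * Real.exp (-(1/4) * ‖w‖ ^ 2) := by
    rw [← Real.exp_add]; ring_nf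
  have h1 := Real.add_one_le_exp (1/4 * ‖w‖ ^ 2)
  have h2 : Real.exp (-(1/4) * ‖w‖ ^ 2) * Real.exp (1/4 * ‖w‖ ^ 2) = 1 := by
    rw [← Real.exp_add]; simp
  rw [e]
  have h3 := Real.exp_pos (-(1/4) * ‖w‖ ^ 2)
  have h4 := sq_nonneg ‖w‖
  have h5 : Real.exp (-(1/4) * ‖w‖ ^ 2) * ‖w‖ ^ 2 ≤ 4 := by nlinarith
  nlinarith

lemma db_std_inner {n : ℕ} (x : dbE n) : ∫ w, ⟪w, x⟫ ∂(stdGaussian n) = 0 := by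
  rw [db_std_integral]
  have h := integral_neg_eq_self (fun w : dbE n => dbphi w * ⟪w, x⟫) volume
  have : (fun w : dbE n => dbphi (-w) * ⟪-w, x⟫) = fun w => -(dbphi w * ⟪w, x⟫) := by
    ext w; simp [dbphi, inner_neg_left]
  simp only [this, integral_neg] at h
  linarith

/-- joint law as a density -/
lemma db_joint {n : ℕ} (r : ℝ) (μ : Measure (dbE n)) [IsProbabilityMeasure μ] :
    Measure.map (fun p : dbE n × dbE n => (p.1, r • p.1 + p.2)) (μ.prod (stdGaussian n)) =
    (μ.prod (stdGaussian n)).withDensity (fun p => ENNReal.ofReal (dbK r p.2 p.1)) := by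
  have hK : Measurable (fun p : dbE n × dbE n => ENNReal.ofReal (dbK r p.2 p.1)) :=
    (dbK_cont r).measurable.ennreal_ofReal
  have hphi : Measurable (fun w : dbE n => ENNReal.ofReal (dbphi w)) :=
    dbphi_cont.measurable.ennreal_ofReal
  refine Measure.ext_of_lintegral _ fun f hf => ?_
  rw [lintegral_map hf (by fun_prop), lintegral_withDensity_eq_lintegral_mul _ hK hf,
    lintegral_prod _ (by fun_prop), lintegral_prod _ (by fun_prop)]
  refine lintegral_congr fun x => ?_
  rw [db_std, lintegral_withDensity_eq_lintegral_mul _ hphi (by fun_prop),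
    lintegral_withDensity_eq_lintegral_mul _ hphi (by fun_prop)]
  refine Eq.trans ?_ (lintegral_add_left_eq_self _ (r • x))
  refine lintegral_congr fun w => ?_
  simp only [Pi.mul_apply]
  rw [← mul_assoc, ← ENNReal.ofReal_mul (dbphi_nonneg _)]
  congr 2
  rw [dbK_eq, add_sub_cancel_left]
  unfold dbphi
  have : Real.exp (-‖r • x + w‖ ^ 2 / 2) * Real.exp (‖r • x + w‖ ^ 2 / 2) = 1 := by
    rw [← Real.exp_add]; ring_nf; simp
  linear_combination (-(2 * π) ^ (-(n : ℝ) / 2) * Real.exp (-‖w‖ ^ 2 / 2)) * this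

lemma db_Kint {n : ℕ} {F : Type*} [NormedAddCommGroup F] [NormedSpace ℝ F] (r : ℝ) (u : dbE n)
    {μ : Measure (dbE n)} {f : dbE n → F} (hf : Integrable f μ) :
    Integrable (fun z => dbK r u z • f z) μ := by
  refine (hf.norm.const_mul (Real.exp (‖u‖ ^ 2 / 2))).mono'
    ((dbK_cont1 r u).aestronglyMeasurable.smul hf.aestronglyMeasurable) ?_
  refine Filter.Eventually.of_forall fun z => ?_
  rw [norm_smul, Real.norm_eq_abs, abs_of_pos (dbK_pos _ _ _)]
  exact mul_le_mul_of_nonneg_right (dbK_le _ _ _) (norm_nonneg _)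

lemma db_Kint0 {n : ℕ} (r : ℝ) (u : dbE n) {μ : Measure (dbE n)} [IsProbabilityMeasure μ] :
    Integrable (fun z => dbK r u z) μ := by
  simpa using db_Kint r u (integrable_const (1 : ℝ) (μ := μ))

lemma db_idint {n : ℕ} {μ : Measure (dbE n)} [IsProbabilityMeasure μ]
    (hsq : Integrable (fun x => ‖x‖ ^ 2) μ) : Integrable (fun x => x) μ := by
  refine (hsq.add (integrable_const (1 : ℝ))).mono' (by fun_prop) ?_
  refine Filter.Eventually.of_forall fun z => ?_
  simp only [Pi.add_apply]
  nlinarith [sq_nonneg (‖z‖ - 1), norm_nonneg z]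

noncomputable def dbS {n : ℕ} (r : ℝ) (μ : Measure (dbE n)) (u : dbE n) : ℝ :=
  (lik n r μ u)⁻¹ * ∫ x, dbK r u x * ‖x‖ ^ 2 ∂μ

section
variable {n : ℕ} (μ : Measure (dbE n)) [IsProbabilityMeasure μ]

lemma db_diff_int (hsq : Integrable (fun x => ‖x‖ ^ 2) μ) (r : ℝ) (u : dbE n) :
    Integrable (fun z => ‖u - r • z‖ ^ 2) μ := by
  refine ((hsq.const_mul (2 * r ^ 2)).add (integrable_const (2 * ‖u‖ ^ 2))).mono' (by fun_prop) ?_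
  refine Filter.Eventually.of_forall fun z => ?_
  simp only [Pi.add_apply]
  rw [Real.norm_eq_abs, abs_of_nonneg (sq_nonneg _)]
  have h := parallelogram_law_with_norm ℝ u (r • z)
  have h2 : ‖r • z‖ ^ 2 = r ^ 2 * ‖z‖ ^ 2 := by
    rw [norm_smul, mul_pow, Real.norm_eq_abs, sq_abs]
  nlinarith [norm_nonneg (u + r • z)]

lemma db_diff_le (hsq : Integrable (fun x => ‖x‖ ^ 2) μ) (r : ℝ) (u : dbE n) :
    ∫ z, ‖u - r • z‖ ^ 2 ∂μ ≤ 2 * ‖u‖ ^ 2 + 2 * r ^ 2 * ∫ z, ‖z‖ ^ 2 ∂μ := by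
  have : ∫ z, (2 * r ^ 2 * ‖z‖ ^ 2 + 2 * ‖u‖ ^ 2) ∂μ
      = 2 * ‖u‖ ^ 2 + 2 * r ^ 2 * ∫ z, ‖z‖ ^ 2 ∂μ := by
    rw [integral_add (hsq.const_mul _) (integrable_const _), integral_const_mul]
    simp
    ring
  rw [← this]
  refine integral_mono (db_diff_int μ hsq r u) ((hsq.const_mul _).add (integrable_const _)) ?_
  intro z
  have h := parallelogram_law_with_norm ℝ u (r • z)
  have h2 : ‖r • z‖ ^ 2 = r ^ 2 * ‖z‖ ^ 2 := by
    rw [norm_smul, mul_pow, Real.norm_eq_abs, sq_abs]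
  show ‖u - r • z‖ ^ 2 ≤ 2 * r ^ 2 * ‖z‖ ^ 2 + 2 * ‖u‖ ^ 2
  nlinarith [norm_nonneg (u + r • z)]

lemma db_S_le (hpos : ∀ r u, 0 < lik n r μ u) (hsq : Integrable (fun x => ‖x‖ ^ 2) μ) (r : ℝ) (u : dbE n) :
    r ^ 2 * dbS r μ u ≤ 6 * ‖u‖ ^ 2 + 4 * r ^ 2 * ∫ z, ‖z‖ ^ 2 ∂μ := by
  have hD := db_diff_int μ hsq r u
  have ha := db_diff_le μ hsq r u
  set a := ∫ z, ‖u - r • z‖ ^ 2 ∂μ with ha_def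
  have hKD : Integrable (fun z => dbK r u z * ‖u - r • z‖ ^ 2) μ := db_Kint r u hD
  have hK2 : Integrable (fun z => dbK r u z * ‖z‖ ^ 2) μ := db_Kint r u hsq
  have hK0 : Integrable (fun z => dbK r u z) μ := db_Kint0 r u
  have h1 : ∫ z, (dbK r u z * ‖u - r • z‖ ^ 2 - dbK r u z * a) ∂μ ≤
      ∫ z, Real.exp (‖u‖ ^ 2 / 2) * Real.exp (-a / 2) * (‖u - r • z‖ ^ 2 - a) ∂μ := by
    refine integral_mono (hKD.sub (hK0.mul_const a))
      ((hD.sub (integrable_const a)).const_mul _) ?_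
    intro z
    show dbK r u z * ‖u - r • z‖ ^ 2 - dbK r u z * a ≤
      Real.exp (‖u‖ ^ 2 / 2) * Real.exp (-a / 2) * (‖u - r • z‖ ^ 2 - a)
    rw [dbK_eq]
    generalize ‖u - r • z‖ ^ 2 = s
    have hc := Real.exp_pos (‖u‖ ^ 2 / 2)
    have key : Real.exp (-s / 2) * (s - a) ≤ Real.exp (-a / 2) * (s - a) := by
      rcases le_total s a with h | h
      · have := Real.exp_le_exp.2 (show -a / 2 ≤ -s / 2 by linarith)
        nlinarith
      · have := Real.exp_le_exp.2 (show -s / 2 ≤ -a / 2 by linarith)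
        nlinarith
    have := mul_le_mul_of_nonneg_left key hc.le
    linarith
  rw [integral_sub hKD (hK0.mul_const a), integral_mul_const, integral_const_mul,
    integral_sub hD (integrable_const a), ← db_lik] at h1
  simp only [integral_const, probReal_univ, one_smul, ← ha_def, sub_self, mul_zero] at h1
  have h2 : ∫ z, r ^ 2 * (dbK r u z * ‖z‖ ^ 2) ∂μ ≤
      ∫ z, (2 * (dbK r u z * ‖u - r • z‖ ^ 2) + dbK r u z * (2 * ‖u‖ ^ 2)) ∂μ := by
    refine integral_mono (hK2.const_mul _) ((hKD.const_mul 2).add (hK0.mul_const _)) ?_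
    intro z
    show r ^ 2 * (dbK r u z * ‖z‖ ^ 2) ≤
      2 * (dbK r u z * ‖u - r • z‖ ^ 2) + dbK r u z * (2 * ‖u‖ ^ 2)
    have h := parallelogram_law_with_norm ℝ u (u - r • z)
    rw [sub_sub_cancel] at h
    have h2 : ‖r • z‖ ^ 2 = r ^ 2 * ‖z‖ ^ 2 := by
      rw [norm_smul, mul_pow, Real.norm_eq_abs, sq_abs]
    have h3 : r ^ 2 * ‖z‖ ^ 2 ≤ 2 * ‖u - r • z‖ ^ 2 + 2 * ‖u‖ ^ 2 := by
      nlinarith [norm_nonneg (u + (u - r • z))]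
    have := mul_le_mul_of_nonneg_left h3 (dbK_pos r u z).le
    linarith
  rw [integral_const_mul, integral_add (hKD.const_mul 2) (hK0.mul_const _), integral_const_mul,
    integral_mul_const, ← db_lik] at h2
  have hl := hpos r u
  unfold dbS
  rw [← mul_assoc, mul_comm (r ^ 2), mul_assoc, inv_mul_le_iff₀ hl]
  nlinarith

lemma db_log_le (hpos : ∀ r u, 0 < lik n r μ u) (hsq : Integrable (fun x => ‖x‖ ^ 2) μ) (r : ℝ) (u : dbE n) :
    |Real.log (lik n r μ u)| ≤ ‖u‖ ^ 2 / 2 + r ^ 2 * ∫ z, ‖z‖ ^ 2 ∂μ := by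
  have hD := db_diff_int μ hsq r u
  have ha := db_diff_le μ hsq r u
  set a := ∫ z, ‖u - r • z‖ ^ 2 ∂μ with ha_def
  have hK0 : Integrable (fun z => dbK r u z) μ := db_Kint0 r u
  have hM : 0 ≤ ∫ z, ‖z‖ ^ 2 ∂μ := integral_nonneg fun z => sq_nonneg _
  have h1 : ∫ z, Real.exp (‖u‖ ^ 2 / 2 - a / 2) * (1 - (‖u - r • z‖ ^ 2 - a) / 2) ∂μ
      ≤ lik n r μ u := by
    rw [db_lik]
    refine integral_mono (((integrable_const _).sub
      ((hD.sub (integrable_const a)).div_const 2)).const_mul _) hK0 ?_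
    intro z
    show Real.exp (‖u‖ ^ 2 / 2 - a / 2) * (1 - (‖u - r • z‖ ^ 2 - a) / 2) ≤ dbK r u z
    rw [dbK_eq]
    generalize ‖u - r • z‖ ^ 2 = s
    have e : Real.exp (‖u‖ ^ 2 / 2) * Real.exp (-s / 2)
        = Real.exp (‖u‖ ^ 2 / 2 - a / 2) * Real.exp (-(s - a) / 2) := by
      rw [← Real.exp_add, ← Real.exp_add]; ring_nf
    rw [e]
    refine mul_le_mul_of_nonneg_left ?_ (Real.exp_pos _).le
    have := Real.add_one_le_exp (-(s - a) / 2)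
    linarith
  have hDa : Integrable (fun z => (‖u - r • z‖ ^ 2 - a) / 2) μ :=
    (hD.sub (integrable_const a)).div_const 2
  rw [integral_const_mul, integral_sub (integrable_const _) hDa, integral_div,
    integral_sub hD (integrable_const a)] at h1
  simp only [integral_const, probReal_univ, one_smul, ← ha_def, sub_self, zero_div, sub_zero,
    mul_one] at h1
  have h2 : lik n r μ u ≤ Real.exp (‖u‖ ^ 2 / 2) := by
    rw [db_lik]
    have := integral_mono hK0 (integrable_const (Real.exp (‖u‖ ^ 2 / 2))) (fun z => dbK_le r u z)
    simpa using this
  have h3 := (Real.le_log_iff_exp_le (hpos r u)).2 h1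
  have h4 := (Real.log_le_iff_le_exp (hpos r u)).2 h2
  have h5 := mul_nonneg (sq_nonneg r) hM
  rw [abs_le]
  constructor <;> nlinarith

lemma db_mean_sq (hpos : ∀ r u, 0 < lik n r μ u) (hsq : Integrable (fun x => ‖x‖ ^ 2) μ) (r : ℝ) (u : dbE n) :
    ‖postMean n r μ u‖ ^ 2 ≤ dbS r μ u := by
  have hid := db_idint hsq
  have hl := hpos r u
  have hK2 : Integrable (fun z => dbK r u z * ‖z‖ ^ 2) μ := db_Kint r u hsq
  have hK1 : Integrable (fun z => dbK r u z • z) μ := db_Kint r u hid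
  have hK0 : Integrable (fun z => dbK r u z) μ := db_Kint0 r u
  set m := postMean n r μ u with hm
  have hI : ∫ x, dbK r u x • x ∂μ = lik n r μ u • m := by
    rw [hm, db_postMean, smul_smul, mul_inv_cancel₀ hl.ne', one_smul]
  have hKi : Integrable (fun z => ⟪dbK r u z • z, m⟫) μ := hK1.inner_const m
  have h : ∫ z, (2 * ⟪dbK r u z • z, m⟫ - dbK r u z * ‖m‖ ^ 2) ∂μ ≤ ∫ z, dbK r u z * ‖z‖ ^ 2 ∂μ := by
    refine integral_mono ((hKi.const_mul 2).sub (hK0.mul_const _)) hK2 ?_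
    intro z
    show 2 * ⟪dbK r u z • z, m⟫ - dbK r u z * ‖m‖ ^ 2 ≤ dbK r u z * ‖z‖ ^ 2
    rw [real_inner_smul_left]
    have h1 := norm_sub_sq_real z m
    have h2 := mul_nonneg (dbK_pos r u z).le (sq_nonneg ‖z - m‖)
    rw [h1] at h2
    linarith
  have h0 : ∫ z, ⟪dbK r u z • z, m⟫ ∂μ = lik n r μ u * ‖m‖ ^ 2 := by
    have : ∫ z, ⟪m, dbK r u z • z⟫ ∂μ = ⟪m, ∫ z, dbK r u z • z ∂μ⟫ := integral_inner hK1 m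
    simp_rw [real_inner_comm m]
    rw [this, hI, real_inner_smul_right, real_inner_self_eq_norm_sq]
  rw [integral_sub (hKi.const_mul 2) (hK0.mul_const _), integral_const_mul, integral_mul_const,
    h0, ← db_lik] at h
  unfold dbS
  rw [le_inv_mul_iff₀ hl]
  linarith

end

section
variable {n : ℕ} (μ : Measure (dbE n)) [IsProbabilityMeasure μ]

lemma db_lik_meas (r : ℝ) : Measurable (fun u => lik n r μ u) := by
  have : StronglyMeasurable (fun p : dbE n × dbE n => dbK r p.1 p.2) := by
    unfold dbK
    exact (by fun_prop : Continuous _).stronglyMeasurable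
  exact (this.integral_prod_right (ν := μ)).measurable

lemma db_mean_meas (r : ℝ) : Measurable (fun u => postMean n r μ u) := by
  have : StronglyMeasurable (fun p : dbE n × dbE n => dbK r p.1 p.2 • p.2) := by
    unfold dbK
    exact (by fun_prop : Continuous _).stronglyMeasurable
  exact (db_lik_meas μ r).inv.smul (this.integral_prod_right (ν := μ)).measurable

lemma db_S_meas (r : ℝ) : Measurable (fun u => dbS r μ u) := by
  have : StronglyMeasurable (fun p : dbE n × dbE n => dbK r p.1 p.2 * ‖p.2‖ ^ 2) := by
    unfold dbK
    exact (by fun_prop : Continuous _).stronglyMeasurable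
  exact (db_lik_meas μ r).inv.mul (this.integral_prod_right (ν := μ)).measurable

lemma db_int_inner (hpos : ∀ r u, 0 < lik n r μ u) (hsq : Integrable (fun x => ‖x‖ ^ 2) μ)
    (r : ℝ) (u v : dbE n) :
    ∫ z, dbK r u z * ⟪z, v⟫ ∂μ = lik n r μ u * ⟪postMean n r μ u, v⟫ := by
  have hK1 : Integrable (fun z => dbK r u z • z) μ := db_Kint r u (db_idint hsq)
  have := integral_inner (𝕜 := ℝ) hK1 v
  rw [db_postMean, real_inner_smul_left, ← mul_assoc, mul_inv_cancel₀ (hpos r u).ne', one_mul,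
    real_inner_comm, ← this]
  refine integral_congr_ae (Filter.Eventually.of_forall fun z => ?_)
  simp only [real_inner_smul_right, real_inner_comm]

lemma db_int_S {n : ℕ} (μ : Measure (dbE n)) (hpos : ∀ r u, 0 < lik n r μ u) (r : ℝ) (u : dbE n) :
    ∫ z, dbK r u z * ‖z‖ ^ 2 ∂μ = lik n r μ u * dbS r μ u := by
  unfold dbS
  rw [← mul_assoc, mul_inv_cancel₀ (hpos r u).ne', one_mul]

/-- gradient of the log-likelihood -/
lemma db_grad (hpos : ∀ r u, 0 < lik n r μ u) (hsq : Integrable (fun x => ‖x‖ ^ 2) μ)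
    (r : ℝ) (u : dbE n) :
    gradient (fun v => Real.log (lik n r μ v)) u = r • postMean n r μ u := by
  have hid := db_idint hsq
  have h : HasFDerivAt (fun v => ∫ x, dbK r v x ∂μ)
      (∫ x, (dbK r u x * r) • (innerSL ℝ x) ∂μ) u := by
    refine hasFDerivAt_integral_of_dominated_of_fderiv_le (F := fun v x => dbK r v x)
      (F' := fun v x => (dbK r v x * r) • (innerSL ℝ x))
      (bound := fun x => Real.exp ((‖u‖ + 1) ^ 2 / 2) * |r| * ‖x‖)
      (Metric.ball_mem_nhds u one_pos) ?_ (db_Kint0 r u) ?_ ?_ ?_ ?_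
    · exact Filter.Eventually.of_forall fun v => (dbK_cont1 r v).aestronglyMeasurable
    · have := dbK_cont1 r u
      exact (by fun_prop : Continuous _).aestronglyMeasurable
    · refine Filter.Eventually.of_forall fun x v hv => ?_
      rw [norm_smul, innerSL_apply_norm, norm_mul, Real.norm_eq_abs, Real.norm_eq_abs,
        abs_of_pos (dbK_pos _ _ _)]
      have hv' : ‖v‖ ≤ ‖u‖ + 1 := by
        rw [mem_ball_iff_norm] at hv
        have := norm_le_norm_add_norm_sub' v u
        linarith
      have : dbK r v x ≤ Real.exp ((‖u‖ + 1) ^ 2 / 2) :=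
        (dbK_le r v x).trans (Real.exp_le_exp.2 (by gcongr))
      gcongr
    · exact hid.norm.const_mul _
    · refine Filter.Eventually.of_forall fun x v _ => ?_
      unfold dbK
      have h1 : HasFDerivAt (fun v : dbE n => ⟪v, x⟫) (innerSL ℝ x) v := by
        have := (innerSL ℝ x).hasFDerivAt (x := v)
        refine this.congr_of_eventuallyEq (Filter.Eventually.of_forall fun v => ?_)
        simp [real_inner_comm]
      have h2 := ((h1.const_mul r).sub_const (r ^ 2 / 2 * ‖x‖ ^ 2)).exp
      rwa [smul_smul] at h2
  have hlog : HasFDerivAt (fun v => Real.log (lik n r μ v))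
      ((lik n r μ u)⁻¹ • ∫ x, (dbK r u x * r) • (innerSL ℝ x) ∂μ) u :=
    HasFDerivAt.log (f := fun v => lik n r μ v) h (hpos r u).ne'
  have hg : HasGradientAt (fun v => Real.log (lik n r μ v)) (r • postMean n r μ u) u := by
    rw [hasGradientAt_iff_hasFDerivAt]
    refine hlog.congr_fderiv ?_
    symm
    refine ContinuousLinearMap.ext fun v => ?_
    have hK1 : Integrable (fun z => dbK r u z • (innerSL ℝ z : dbE n →L[ℝ] ℝ)) μ :=
      db_Kint r u ((innerSL ℝ).integrable_comp hid)
    have hK1' : Integrable (fun z => (dbK r u z * r) • (innerSL ℝ z : dbE n →L[ℝ] ℝ)) μ := by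
      refine (hK1.smul r).congr (Filter.Eventually.of_forall fun z => ?_)
      simp [smul_smul, mul_comm]
    rw [smul_apply, ContinuousLinearMap.integral_apply hK1']
    simp only [InnerProductSpace.toDual_apply_apply, smul_apply,
      innerSL_apply_apply, smul_eq_mul]
    have := db_int_inner μ hpos hsq r u v
    simp_rw [mul_right_comm _ r]
    rw [integral_mul_const, this, real_inner_smul_left]
    have := (hpos r u).ne'
    field_simp
  exact hg.gradient

/-- derivative of the log-likelihood along the channel -/
lemma db_deriv (hpos : ∀ r u, 0 < lik n r μ u) (hsq : Integrable (fun x => ‖x‖ ^ 2) μ)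
    (r : ℝ) (x w : dbE n) :
    HasDerivAt (fun s => Real.log (lik n s μ (s • x + w)))
      (⟪postMean n r μ (r • x + w), (2 * r) • x + w⟫ - r * dbS r μ (r • x + w)) r := by
  have hid := db_idint hsq
  have h : HasDerivAt (fun s => ∫ z, dbK s (s • x + w) z ∂μ)
      (∫ z, dbK r (r • x + w) z * (⟪z, (2 * r) • x + w⟫ - r * ‖z‖ ^ 2) ∂μ) r := by
    refine (hasDerivAt_integral_of_dominated_loc_of_deriv_le
      (F := fun s z => dbK s (s • x + w) z)
      (F' := fun s z => dbK s (s • x + w) z * (⟪z, (2 * s) • x + w⟫ - s * ‖z‖ ^ 2))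
      (bound := fun z => Real.exp (((|r| + 1) * ‖x‖ + ‖w‖) ^ 2 / 2) *
        ((2 * (|r| + 1) * ‖x‖ + ‖w‖) * ‖z‖ + (|r| + 1) * ‖z‖ ^ 2))
      (Metric.ball_mem_nhds r one_pos) ?_ (db_Kint0 r _) ?_ ?_ ?_ ?_).2
    · exact Filter.Eventually.of_forall fun v => (dbK_cont1 _ _).aestronglyMeasurable
    · have := dbK_cont1 r (r • x + w)
      exact (by fun_prop : Continuous _).aestronglyMeasurable
    · refine Filter.Eventually.of_forall fun z s hs => ?_
      have hs' : |s| ≤ |r| + 1 := by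
        rw [mem_ball_iff_norm] at hs
        have := norm_le_norm_add_norm_sub' s r
        simp only [Real.norm_eq_abs] at this hs
        linarith
      rw [norm_mul, Real.norm_eq_abs, abs_of_pos (dbK_pos _ _ _)]
      have hn : ‖s • x + w‖ ≤ (|r| + 1) * ‖x‖ + ‖w‖ := by
        refine (norm_add_le _ _).trans ?_
        rw [norm_smul, Real.norm_eq_abs]
        gcongr
      have h1 : dbK s (s • x + w) z ≤ Real.exp (((|r| + 1) * ‖x‖ + ‖w‖) ^ 2 / 2) :=
        (dbK_le _ _ _).trans (Real.exp_le_exp.2 (by gcongr))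
      have h2 : ‖⟪z, (2 * s) • x + w⟫ - s * ‖z‖ ^ 2‖ ≤
          ((2 * (|r| + 1) * ‖x‖ + ‖w‖) * ‖z‖ + (|r| + 1) * ‖z‖ ^ 2) := by
        refine (norm_sub_le _ _).trans ?_
        have e1 : ‖⟪z, (2 * s) • x + w⟫‖ ≤ (2 * (|r| + 1) * ‖x‖ + ‖w‖) * ‖z‖ := by
          refine (norm_inner_le_norm _ _).trans ?_
          rw [mul_comm]
          have : ‖(2 * s) • x + w‖ ≤ 2 * (|r| + 1) * ‖x‖ + ‖w‖ := by
            refine (norm_add_le _ _).trans ?_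
            rw [norm_smul, Real.norm_eq_abs, abs_mul, abs_two]
            gcongr
          gcongr
        have e2 : ‖s * ‖z‖ ^ 2‖ ≤ (|r| + 1) * ‖z‖ ^ 2 := by
          rw [norm_mul, Real.norm_eq_abs, norm_pow, norm_norm]
          gcongr
        exact add_le_add e1 e2
      gcongr
    · exact ((hid.norm.const_mul _).add (hsq.const_mul _)).const_mul _
    · refine Filter.Eventually.of_forall fun z s _ => ?_
      unfold dbK
      have e : ∀ t : ℝ, t * ⟪t • x + w, z⟫ - t ^ 2 / 2 * ‖z‖ ^ 2
          = t ^ 2 * (⟪x, z⟫ - ‖z‖ ^ 2 / 2) + t * ⟪w, z⟫ := by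
        intro t
        rw [inner_add_left, real_inner_smul_left]; ring
      have h1 : HasDerivAt (fun t : ℝ => t ^ 2 * (⟪x, z⟫ - ‖z‖ ^ 2 / 2) + t * ⟪w, z⟫)
          (⟪z, (2 * s) • x + w⟫ - s * ‖z‖ ^ 2) s := by
        have := (((hasDerivAt_id s).pow 2).mul_const (⟪x, z⟫ - ‖z‖ ^ 2 / 2)).add
          ((hasDerivAt_id s).mul_const ⟪w, z⟫)
        refine this.congr_deriv ?_
        simp only [id, inner_add_right, real_inner_smul_right, real_inner_comm]
        rw [real_inner_comm z x, real_inner_comm z w]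
        push_cast
        ring
      simp only [e]
      exact h1.exp
  have hlog := HasDerivAt.log (f := fun s => lik n s μ (s • x + w)) h (hpos r (r • x + w)).ne'
  refine hlog.congr_deriv ?_
  have i1 : Integrable (fun z => dbK r (r • x + w) z * ⟪z, (2 * r) • x + w⟫) μ :=
    db_Kint r _ (hid.inner_const _)
  have i2 : Integrable (fun z => dbK r (r • x + w) z * ‖z‖ ^ 2) μ := db_Kint r _ hsq
  have : ∫ z, dbK r (r • x + w) z * (⟪z, (2 * r) • x + w⟫ - r * ‖z‖ ^ 2) ∂μ =
      lik n r μ (r • x + w) * (⟪postMean n r μ (r • x + w), (2 * r) • x + w⟫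
        - r * dbS r μ (r • x + w)) := by
    rw [mul_sub, ← db_int_inner μ hpos hsq, mul_left_comm, ← db_int_S μ hpos, ← integral_const_mul,
      ← integral_sub i1 (i2.const_mul r)]
    refine integral_congr_ae (Filter.Eventually.of_forall fun z => ?_)
    ring
  rw [this, mul_div_cancel_left₀ _ (hpos _ _).ne']

/-- tower property -/
lemma db_tower (r : ℝ) {H : dbE n → dbE n → ℝ} {g : dbE n → ℝ}
    (hH : Measurable (fun p : dbE n × dbE n => H p.1 p.2)) (hg : Measurable g)
    (iH : Integrable (fun p : dbE n × dbE n => H p.1 (r • p.1 + p.2)) (μ.prod (stdGaussian n)))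
    (ig : Integrable (fun p : dbE n × dbE n => g (r • p.1 + p.2)) (μ.prod (stdGaussian n)))
    (hgH : ∀ u, ∫ z, dbK r u z * H z u ∂μ = lik n r μ u * g u) :
    ∫ p : dbE n × dbE n, H p.1 (r • p.1 + p.2) ∂(μ.prod (stdGaussian n)) =
    ∫ p : dbE n × dbE n, g (r • p.1 + p.2) ∂(μ.prod (stdGaussian n)) := by
  have hKm : Measurable (fun p : dbE n × dbE n => ENNReal.ofReal (dbK r p.2 p.1)) :=
    (dbK_cont r).measurable.ennreal_ofReal
  have hT : Measurable (fun p : dbE n × dbE n => (p.1, r • p.1 + p.2)) := by fun_prop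
  have gen : ∀ f : dbE n × dbE n → ℝ, Measurable f →
      Integrable (fun p : dbE n × dbE n => f (p.1, r • p.1 + p.2)) (μ.prod (stdGaussian n)) →
      ∫ p : dbE n × dbE n, f (p.1, r • p.1 + p.2) ∂(μ.prod (stdGaussian n)) =
      ∫ u, ∫ z, dbK r u z * f (z, u) ∂μ ∂(stdGaussian n) := by
    intro f hf hfi
    have h1 : Integrable f (Measure.map (fun p : dbE n × dbE n => (p.1, r • p.1 + p.2))
        (μ.prod (stdGaussian n))) :=
      (integrable_map_measure hf.aestronglyMeasurable hT.aemeasurable).2 hfi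
    rw [db_joint, integrable_withDensity_iff_integrable_smul' hKm
      (Filter.Eventually.of_forall fun x => ENNReal.ofReal_lt_top)] at h1
    simp only [ENNReal.toReal_ofReal (dbK_pos _ _ _).le, smul_eq_mul] at h1
    rw [← integral_map hT.aemeasurable hf.aestronglyMeasurable, db_joint,
      integral_withDensity_eq_integral_toReal_smul hKm
      (Filter.Eventually.of_forall fun x => ENNReal.ofReal_lt_top)]
    simp only [ENNReal.toReal_ofReal (dbK_pos _ _ _).le, smul_eq_mul]
    exact integral_prod_symm _ h1
  rw [gen (fun p => H p.1 p.2) hH iH, gen (fun p => g p.2) (hg.comp measurable_snd) ig]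
  refine integral_congr_ae (Filter.Eventually.of_forall fun u => ?_)
  simp only
  rw [hgH, integral_mul_const, ← db_lik]

end

lemma db_S_nonneg {n : ℕ} (μ : Measure (dbE n)) (r : ℝ) (u : dbE n) : 0 ≤ dbS r μ u := by
  unfold dbS
  refine mul_nonneg (inv_nonneg.2 ?_) ?_
  · rw [db_lik]; exact integral_nonneg fun z => (dbK_pos _ _ _).le
  · exact integral_nonneg fun z => mul_nonneg (dbK_pos _ _ _).le (sq_nonneg _)

lemma db_y_sq {n : ℕ} (s : ℝ) (x w : dbE n) :
    ‖s • x + w‖ ^ 2 ≤ 2 * s ^ 2 * ‖x‖ ^ 2 + 2 * ‖w‖ ^ 2 := by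
  have h := parallelogram_law_with_norm ℝ (s • x) w
  have h2 : ‖s • x‖ ^ 2 = s ^ 2 * ‖x‖ ^ 2 := by
    rw [norm_smul, mul_pow, Real.norm_eq_abs, sq_abs]
  nlinarith [norm_nonneg (s • x - w)]

lemma db_inner_abs {n : ℕ} (a b : dbE n) : |⟪a, b⟫| ≤ ‖a‖ ^ 2 / 2 + ‖b‖ ^ 2 / 2 := by
  have := abs_real_inner_le_norm a b
  nlinarith [sq_nonneg (‖a‖ - ‖b‖)]

noncomputable def dbT {n : ℕ} (ρ M : ℝ) (p : dbE n × dbE n) : ℝ :=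
  12 * ‖p.1‖ ^ 2 + 48 / ρ ^ 2 * ‖p.2‖ ^ 2 + 4 * M

lemma db_S_T {n : ℕ} (μ : Measure (dbE n)) [IsProbabilityMeasure μ]
    (hpos : ∀ r u, 0 < lik n r μ u) (hsq : Integrable (fun x => ‖x‖ ^ 2) μ)
    {ρ s : ℝ} (hρ : 0 < ρ) (hs : ρ / 2 < s) (p : dbE n × dbE n) :
    dbS s μ (s • p.1 + p.2) ≤ dbT ρ (∫ z, ‖z‖ ^ 2 ∂μ) p := by
  have h1 := db_S_le μ hpos hsq s (s • p.1 + p.2)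
  have h2 := db_y_sq s p.1 p.2
  have hs0 : 0 < s := by linarith
  have hs2 : 0 < s ^ 2 := by positivity
  refine le_of_mul_le_mul_left (h1.trans ?_) hs2
  unfold dbT
  have h3 : 1 ≤ s ^ 2 * (4 / ρ ^ 2) := by
    rw [mul_div_assoc', le_div_iff₀ (by positivity)]
    nlinarith
  have h4 := mul_le_mul_of_nonneg_right h3 (sq_nonneg ‖p.2‖)
  have e : s ^ 2 * (48 / ρ ^ 2 * ‖p.2‖ ^ 2) = 12 * (s ^ 2 * (4 / ρ ^ 2) * ‖p.2‖ ^ 2) := by ring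
  rw [mul_add, mul_add, e]
  linarith

/-- extended de Bruijn: (d/dρ) E₁[log ℓ] = ρ E₁|E[x|y]|² = ρ⁻¹ E₁|∇ log ℓ|². -/
theorem extended_de_Bruijn (n : ℕ) (ρ : ℝ) (hρ : 0 < ρ)
    (μX : Measure (EuclideanSpace ℝ (Fin n))) [IsProbabilityMeasure μX]
    (hexp : ∀ (α : ℝ) (h : EuclideanSpace ℝ (Fin n)),
      Integrable (fun x => Real.exp (α * ⟪x, h⟫)) μX)
    (hpos : ∀ r u, 0 < lik n r μX u) :
    HasDerivAt (fun r => ∫ u, Real.log (lik n r μX u) ∂(lawY n r μX))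
      (ρ * ∫ u, ‖postMean n ρ μX u‖ ^ 2 ∂(lawY n ρ μX)) ρ ∧
    ρ * ∫ u, ‖postMean n ρ μX u‖ ^ 2 ∂(lawY n ρ μX)
      = ρ⁻¹ * ∫ u, ‖gradient (fun v => Real.log (lik n ρ μX v)) u‖ ^ 2 ∂(lawY n ρ μX) := by
  have hsq : Integrable (fun x => ‖x‖ ^ 2) μX := db_sq μX hexp
  have hY : ∀ (r : ℝ) (f : dbE n → ℝ), Measurable f → ∫ u, f u ∂(lawY n r μX) =
      ∫ p : dbE n × dbE n, f (r • p.1 + p.2) ∂(μX.prod (stdGaussian n)) := by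
    intro r f hf
    unfold lawY
    rw [integral_map (by fun_prop) hf.aestronglyMeasurable]
  constructor
  swap
  · simp_rw [db_grad μX hpos hsq, norm_smul, mul_pow, Real.norm_eq_abs, sq_abs]
    rw [integral_const_mul, ← mul_assoc]
    congr 1
    field_simp
  set P := μX.prod (stdGaussian n) with hP
  set M := ∫ z, ‖z‖ ^ 2 ∂μX with hM
  have i1 : Integrable (fun p : dbE n × dbE n => ‖p.1‖ ^ 2) P := hsq.comp_fst _
  have i2 : Integrable (fun p : dbE n × dbE n => ‖p.2‖ ^ 2) P := (db_std_sq n).comp_snd _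
  have iT : Integrable (dbT (n := n) ρ M) P :=
    ((i1.const_mul _).add (i2.const_mul _)).add (integrable_const _)
  have iY : Integrable (fun p : dbE n × dbE n => ‖ρ • p.1 + p.2‖ ^ 2) P := by
    refine ((i1.const_mul (2 * ρ ^ 2)).add (i2.const_mul 2)).mono' (by fun_prop) ?_
    refine Filter.Eventually.of_forall fun p => ?_
    rw [Real.norm_eq_abs, abs_of_nonneg (sq_nonneg _)]
    exact db_y_sq ρ p.1 p.2
  have lm := fun r => db_lik_meas μX r
  have mm := fun r => db_mean_meas μX r
  have sm := fun r => db_S_meas μX r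
  have hfun : (fun r => ∫ u, Real.log (lik n r μX u) ∂(lawY n r μX)) =
      fun r => ∫ p : dbE n × dbE n, Real.log (lik n r μX (r • p.1 + p.2)) ∂P := by
    ext r
    exact hY r _ (lm r).log
  have hder : HasDerivAt
      (fun r => ∫ p : dbE n × dbE n, Real.log (lik n r μX (r • p.1 + p.2)) ∂P)
      (∫ p : dbE n × dbE n, (⟪postMean n ρ μX (ρ • p.1 + p.2), (2 * ρ) • p.1 + p.2⟫
        - ρ * dbS ρ μX (ρ • p.1 + p.2)) ∂P) ρ := by
    refine (hasDerivAt_integral_of_dominated_loc_of_deriv_le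
      (F := fun r (p : dbE n × dbE n) => Real.log (lik n r μX (r • p.1 + p.2)))
      (F' := fun r (p : dbE n × dbE n) =>
        ⟪postMean n r μX (r • p.1 + p.2), (2 * r) • p.1 + p.2⟫ - r * dbS r μX (r • p.1 + p.2))
      (bound := fun p => (1 / 2 + 2 * ρ) * dbT ρ M p + (16 * ρ ^ 2 * ‖p.1‖ ^ 2 + ‖p.2‖ ^ 2))
      (Metric.ball_mem_nhds ρ (half_pos hρ)) ?_ ?_ ?_ ?_ ?_ ?_).2
    · exact Filter.Eventually.of_forall fun r =>
        ((lm r).log.comp (by fun_prop)).aestronglyMeasurable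
    · refine ((iY.div_const 2).add (integrable_const (ρ ^ 2 * M))).mono'
        ((lm ρ).log.comp (by fun_prop)).aestronglyMeasurable ?_
      exact Filter.Eventually.of_forall fun p => db_log_le μX hpos hsq ρ _
    · have m1 := (mm ρ).comp
        (by fun_prop : Measurable fun p : dbE n × dbE n => ρ • p.1 + p.2)
      have m2 := (sm ρ).comp
        (by fun_prop : Measurable fun p : dbE n × dbE n => ρ • p.1 + p.2)
      exact ((m1.inner (by fun_prop)).sub (m2.const_mul ρ)).aestronglyMeasurable
    · refine Filter.Eventually.of_forall fun p s hs => ?_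
      rw [Metric.mem_ball, Real.dist_eq, abs_lt] at hs
      have hs1 : ρ / 2 < s := by linarith [hs.1]
      have hs2 : s < 2 * ρ := by linarith [hs.2]
      have hs0 : 0 < s := by linarith
      have a1 := db_S_T μX hpos hsq hρ hs1 p
      have a2 := db_mean_sq μX hpos hsq s (s • p.1 + p.2)
      have a3 := db_S_nonneg μX s (s • p.1 + p.2)
      have a4 := db_inner_abs (postMean n s μX (s • p.1 + p.2)) ((2 * s) • p.1 + p.2)
      have a5 := db_y_sq (2 * s) p.1 p.2
      rw [Real.norm_eq_abs]
      refine (abs_sub _ _).trans ?_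
      rw [abs_of_nonneg (mul_nonneg hs0.le a3)]
      have a6 : s * dbS s μX (s • p.1 + p.2) ≤ 2 * ρ * dbT ρ M p := by gcongr
      have a7 : (2 * s) ^ 2 * ‖p.1‖ ^ 2 ≤ 16 * ρ ^ 2 * ‖p.1‖ ^ 2 := by
        refine mul_le_mul_of_nonneg_right ?_ (sq_nonneg _)
        nlinarith
      linarith
    · exact (iT.const_mul _).add ((i1.const_mul _).add i2)
    · exact Filter.Eventually.of_forall fun p s _ => db_deriv μX hpos hsq s p.1 p.2
  rw [hfun]
  refine hder.congr_deriv ?_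
  rw [hY ρ _ ((mm ρ).norm.pow_const 2)]
  have hρ2 : ρ / 2 < ρ := by linarith
  have hT := fun p : dbE n × dbE n => db_S_T μX hpos hsq hρ hρ2 p
  have hm := fun u : dbE n => db_mean_sq μX hpos hsq ρ u
  have hS0 := fun u : dbE n => db_S_nonneg μX ρ u
  have my : Measurable fun p : dbE n × dbE n => ρ • p.1 + p.2 := by fun_prop
  have mmy := (mm ρ).comp my
  have dom : ∀ f : dbE n × dbE n → ℝ, Measurable f →
      (∀ p, |f p| ≤ ‖p.1‖ ^ 2 + ‖ρ • p.1 + p.2‖ ^ 2 + dbT ρ M p) → Integrable f P := by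
    intro f hf hb
    exact ((i1.add iY).add iT).mono' hf.aestronglyMeasurable (Filter.Eventually.of_forall hb)
  have jxm : Integrable (fun p : dbE n × dbE n => ⟪p.1, postMean n ρ μX (ρ • p.1 + p.2)⟫) P := by
    refine dom _ (measurable_fst.inner mmy) fun p => ?_
    have := db_inner_abs p.1 (postMean n ρ μX (ρ • p.1 + p.2))
    linarith [hT p, hm (ρ • p.1 + p.2), hS0 (ρ • p.1 + p.2), sq_nonneg ‖p.1‖,
      sq_nonneg ‖ρ • p.1 + p.2‖]
  have jmm : Integrable (fun p : dbE n × dbE n =>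
      ⟪postMean n ρ μX (ρ • p.1 + p.2), postMean n ρ μX (ρ • p.1 + p.2)⟫) P := by
    refine dom _ (mmy.inner mmy) fun p => ?_
    have := db_inner_abs (postMean n ρ μX (ρ • p.1 + p.2)) (postMean n ρ μX (ρ • p.1 + p.2))
    linarith [hT p, hm (ρ • p.1 + p.2), hS0 (ρ • p.1 + p.2), sq_nonneg ‖p.1‖,
      sq_nonneg ‖ρ • p.1 + p.2‖]
  have jxy : Integrable (fun p : dbE n × dbE n => ⟪p.1, ρ • p.1 + p.2⟫) P := by
    refine dom _ (measurable_fst.inner my) fun p => ?_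
    have := db_inner_abs p.1 (ρ • p.1 + p.2)
    linarith [hT p, hm (ρ • p.1 + p.2), hS0 (ρ • p.1 + p.2), sq_nonneg ‖p.1‖,
      sq_nonneg ‖ρ • p.1 + p.2‖]
  have jmy : Integrable (fun p : dbE n × dbE n =>
      ⟪postMean n ρ μX (ρ • p.1 + p.2), ρ • p.1 + p.2⟫) P := by
    refine dom _ (mmy.inner my) fun p => ?_
    have := db_inner_abs (postMean n ρ μX (ρ • p.1 + p.2)) (ρ • p.1 + p.2)
    linarith [hT p, hm (ρ • p.1 + p.2), hS0 (ρ • p.1 + p.2), sq_nonneg ‖p.1‖,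
      sq_nonneg ‖ρ • p.1 + p.2‖]
  have jS : Integrable (fun p : dbE n × dbE n => dbS ρ μX (ρ • p.1 + p.2)) P := by
    refine dom _ ((sm ρ).comp my) fun p => ?_
    rw [abs_of_nonneg (hS0 _)]
    linarith [hT p, sq_nonneg ‖p.1‖, sq_nonneg ‖ρ • p.1 + p.2‖]
  have A := db_tower μX ρ (H := fun z u => ⟪z, postMean n ρ μX u⟫)
    (g := fun u => ⟪postMean n ρ μX u, postMean n ρ μX u⟫)
    (measurable_fst.inner ((mm ρ).comp measurable_snd)) ((mm ρ).inner (mm ρ)) jxm jmm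
    (fun u => db_int_inner μX hpos hsq ρ u _)
  have B := db_tower μX ρ (H := fun z u => ⟪z, u⟫)
    (g := fun u => ⟪postMean n ρ μX u, u⟫)
    (measurable_fst.inner measurable_snd) ((mm ρ).inner measurable_id) jxy jmy
    (fun u => db_int_inner μX hpos hsq ρ u _)
  have C := db_tower μX ρ (H := fun z _ => ‖z‖ ^ 2)
    (g := fun u => dbS ρ μX u)
    (measurable_fst.norm.pow_const 2) (sm ρ) i1 jS
    (fun u => db_int_S μX hpos ρ u)
  rw [← hP] at A B C
  have jxw : Integrable (fun p : dbE n × dbE n => ⟪p.2, p.1⟫) P := by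
    refine (i1.add i2).mono' (measurable_snd.inner measurable_fst).aestronglyMeasurable ?_
    refine Filter.Eventually.of_forall fun p => ?_
    have := db_inner_abs p.2 p.1
    rw [Real.norm_eq_abs]
    simp only [Pi.add_apply]
    linarith [sq_nonneg ‖p.1‖, sq_nonneg ‖p.2‖]
  have D : ∫ p : dbE n × dbE n, ⟪p.1, ρ • p.1 + p.2⟫ ∂P = ρ * ∫ p, ‖p.1‖ ^ 2 ∂P := by
    have z : ∫ p : dbE n × dbE n, ⟪p.2, p.1⟫ ∂P = 0 := by
      rw [hP, integral_prod _ jxw]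
      simp only [db_std_inner, integral_zero]
    have e : (fun p : dbE n × dbE n => ⟪p.1, ρ • p.1 + p.2⟫)
        = fun p => ρ * ‖p.1‖ ^ 2 + ⟪p.2, p.1⟫ := by
      ext p
      rw [inner_add_right, real_inner_smul_right, real_inner_self_eq_norm_sq, real_inner_comm]
    rw [e, integral_add (i1.const_mul ρ) jxw, integral_const_mul, z, add_zero]
  have e : (fun p : dbE n × dbE n => ⟪postMean n ρ μX (ρ • p.1 + p.2), (2 * ρ) • p.1 + p.2⟫
        - ρ * dbS ρ μX (ρ • p.1 + p.2)) = fun p =>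
      (ρ * ⟪p.1, postMean n ρ μX (ρ • p.1 + p.2)⟫
        + ⟪postMean n ρ μX (ρ • p.1 + p.2), ρ • p.1 + p.2⟫)
        - ρ * dbS ρ μX (ρ • p.1 + p.2) := by
    ext p
    have : (2 * ρ) • p.1 + p.2 = ρ • p.1 + (ρ • p.1 + p.2) := by module
    rw [this, inner_add_right _ (ρ • p.1) (ρ • p.1 + p.2), real_inner_smul_right,
      real_inner_comm p.1]
  have jsum : Integrable (fun p : dbE n × dbE n =>
      ρ * ⟪p.1, postMean n ρ μX (ρ • p.1 + p.2)⟫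
        + ⟪postMean n ρ μX (ρ • p.1 + p.2), ρ • p.1 + p.2⟫) P := (jxm.const_mul ρ).add jmy
  rw [e, integral_sub jsum (jS.const_mul ρ),
    integral_add (jxm.const_mul ρ) jmy, integral_const_mul, integral_const_mul, A, ← B, D, ← C]
  simp_rw [real_inner_self_eq_norm_sq]
  ring
end
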